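/- arXiv:2004.09425 — 9 statements merged into one kernel-verified Lean document; each statement's English description precedes it below -/
import Mathlib

section
/- Let G be a connected graph with at least one vertex and let M be a monitor in G. Then every inclusion-maximal clique of G intersects M; in particular, the clique number of G − M is strictly smaller than the clique number of G. -/
/-- A set `M` is a *monitor* in `G` if for every connected component `C` of `G − M`
there is a vertex `w ∈ M` adjacent (in `G`) to every vertex of `C`. -/
def Monitor {V : Type*} (G : SimpleGraph V) (M : Set V) : Prop :=
  ∀ C : (G.induce Mᶜ).ConnectedComponent,
    ∃ w ∈ M, ∀ v : ↥(Mᶜ), (G.induce Mᶜ).connectedComponentMk v = C → G.Adj w ↑v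

theorem monitor_extend {V : Type*} (G : SimpleGraph V) (hG : G.Connected)
    (M : Set V) (hM : Monitor G M) (K : Finset V) (hK : G.IsClique (K : Set V))
    (hd : ∀ v ∈ K, v ∉ M) : ∃ w, w ∉ K ∧ G.IsClique (insert w (K : Set V)) := by
  rcases K.eq_empty_or_nonempty with rfl | ⟨u, hu⟩
  · obtain ⟨v⟩ := hG.nonempty
    exact ⟨v, by simp, by simp⟩
  · obtain ⟨w, hw, hadj⟩ := hM ((G.induce Mᶜ).connectedComponentMk ⟨u, hd u hu⟩)
    refine ⟨w, fun h => hd w h hw, hK.insert ?_⟩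
    intro b hb _
    refine hadj ⟨b, hd b hb⟩ ?_
    by_cases hbu : b = u
    · subst hbu; rfl
    · apply SimpleGraph.ConnectedComponent.sound
      apply SimpleGraph.Adj.reachable
      exact hK hb hu hbu

/-- If `G` is connected (hence has a vertex) and `M` is a monitor in `G`,
then every inclusion-maximal clique of `G` intersects `M`; in particular
`ω(G − M) < ω(G)`. -/
theorem stmt1 {V : Type*} [Fintype V] (G : SimpleGraph V) (hG : G.Connected)
    (M : Set V) (hM : Monitor G M) :
    (∀ K : Finset V, Maximal (fun s : Finset V => G.IsClique ↑s) K → ∃ v ∈ K, v ∈ M) ∧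
      (G.induce Mᶜ).cliqueNum < G.cliqueNum := by
  classical
  constructor
  · intro K hK
    by_contra! hcon
    obtain ⟨w, hw, hc⟩ := monitor_extend G hG M hM K hK.prop hcon
    have h1 : G.IsClique ((insert w K : Finset V) : Set V) := by
      rw [Finset.coe_insert]; exact hc
    exact hw (hK.le_of_ge h1 (Finset.subset_insert w K) (Finset.mem_insert_self w K))
  · obtain ⟨t, ht⟩ := (G.induce Mᶜ).exists_isNClique_cliqueNum
    have hK : G.IsClique ((t.map (Function.Embedding.subtype _) : Finset V) : Set V) := by
      intro a ha b hb hab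
      simp only [Finset.coe_map, Set.mem_image, Finset.mem_coe] at ha hb
      obtain ⟨a, ha, rfl⟩ := ha
      obtain ⟨b, hb, rfl⟩ := hb
      exact ht.isClique ha hb (fun h => hab (by rw [h]))
    obtain ⟨w, hw, hc⟩ := monitor_extend G hG M hM _ hK (by
      intro v hv
      obtain ⟨a, ha, rfl⟩ := Finset.mem_map.1 hv
      exact a.2)
    rw [← Finset.coe_insert] at hc
    have h2 := hc.card_le_cliqueNum
    rw [Finset.card_insert_of_notMem hw, Finset.card_map, ht.card_eq] at h2
    exact h2
end

section
/- Let G be a connected P6-free graph. Then for every vertex u ∈ V(G) there exists a subset X ⊆ V(G) such that u ∈ X, |X| ≤ 3, G[X] is an induced path having u as one of its endpoints, and N_G[X] is a monitor in G. -/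
/-- The closed neighborhood `N_G[X]` of a set `X`. -/
def closedNbhd {V : Type*} (G : SimpleGraph V) (X : Set V) : Set V :=
  X ∪ {v | ∃ x ∈ X, G.Adj x v}


namespace MonP6
variable {V : Type*} (G : SimpleGraph V)

/-- Connectedness of a vertex set in cut form. -/
def Conn (D : Set V) : Prop := ∀ P : V → Prop, (∃ a ∈ D, P a) → (∃ b ∈ D, ¬ P b) →
  ∃ a ∈ D, ∃ b ∈ D, G.Adj a b ∧ P a ∧ ¬ P b

/-- No vertex is complete to `D`. -/
def Bad (D : Set V) : Prop := ∀ w, ∃ d ∈ D, ¬ G.Adj w d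

/-- `D` is a component of `G - S`. -/
def IsComp (S D : Set V) : Prop :=
  D.Nonempty ∧ (∀ d ∈ D, d ∉ S) ∧ Conn G D ∧ ∀ d ∈ D, ∀ e, G.Adj d e → e ∈ D ∨ e ∈ S

lemma conn_of_reach (D : Set V)
    (h : ∀ a ∈ D, ∀ b ∈ D, Relation.ReflTransGen (fun x y => x ∈ D ∧ y ∈ D ∧ G.Adj x y) a b) :
    Conn G D := by
  rintro P ⟨a, ha, hPa⟩ ⟨b, hb, hPb⟩
  have := h a ha b hb
  by_contra hcon
  push Not at hcon
  apply hPb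
  clear hPb hb
  induction this with
  | refl => exact hPa
  | tail _ h2 ih => exact hcon _ h2.1 _ h2.2.1 h2.2.2 ih

lemma comp_of_cc (S : Set V) (C : (G.induce Sᶜ).ConnectedComponent) :
    IsComp G S {v | ∃ h : v ∈ Sᶜ, (G.induce Sᶜ).connectedComponentMk ⟨v, h⟩ = C} := by
  refine ⟨?_, ?_, ?_, ?_⟩
  · induction C using SimpleGraph.ConnectedComponent.ind with
    | h v => exact ⟨v.1, v.2, rfl⟩
  · rintro d ⟨h, -⟩; exact h
  · apply conn_of_reach
    rintro a ⟨ha, hac⟩ b ⟨hb, hbc⟩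
    have hr : (G.induce Sᶜ).Reachable ⟨a, ha⟩ ⟨b, hb⟩ :=
      SimpleGraph.ConnectedComponent.exact (hac.trans hbc.symm)
    rw [SimpleGraph.reachable_iff_reflTransGen] at hr
    have key : ∀ y : ↥(Sᶜ), Relation.ReflTransGen (G.induce Sᶜ).Adj ⟨a, ha⟩ y →
        (G.induce Sᶜ).connectedComponentMk y = C ∧
        Relation.ReflTransGen (fun x y =>
        x ∈ {v | ∃ h : v ∈ Sᶜ, (G.induce Sᶜ).connectedComponentMk ⟨v, h⟩ = C} ∧
        y ∈ {v | ∃ h : v ∈ Sᶜ, (G.induce Sᶜ).connectedComponentMk ⟨v, h⟩ = C} ∧ G.Adj x y)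
        a y.1 := by
      intro y hy
      induction hy with
      | refl => exact ⟨hac, Relation.ReflTransGen.refl⟩
      | @tail p q _ h2 ih =>
        have hq : (G.induce Sᶜ).connectedComponentMk q = C := by
          rw [← ih.1]
          exact SimpleGraph.ConnectedComponent.sound h2.symm.reachable
        exact ⟨hq, ih.2.tail ⟨⟨p.2, ih.1⟩, ⟨q.2, hq⟩, by simpa using h2⟩⟩
    exact (key ⟨b, hb⟩ hr).2
  · rintro d ⟨hd, hdc⟩ e hde
    by_cases he : e ∈ S
    · exact Or.inr he
    · refine Or.inl ⟨he, ?_⟩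
      rw [← hdc]
      apply SimpleGraph.ConnectedComponent.sound
      apply SimpleGraph.Adj.reachable
      simpa using hde.symm

lemma exists_comp (S : Set V) (a : V) (ha : a ∉ S) : ∃ D, IsComp G S D ∧ a ∈ D :=
  ⟨_, comp_of_cc G S ((G.induce Sᶜ).connectedComponentMk ⟨a, ha⟩), ha, rfl⟩

lemma monitor_of (S : Set V) (h : ∀ D, IsComp G S D → ¬ Bad G D) : Monitor G S := by
  intro C
  have hc := comp_of_cc G S C
  have hb := h _ hc
  unfold Bad at hb
  push Not at hb
  obtain ⟨w, hw⟩ := hb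
  refine ⟨w, ?_, fun v hv => hw v.1 ⟨v.2, hv⟩⟩
  obtain ⟨d, hd⟩ := hc.1
  rcases hc.2.2.2 d hd w (hw d hd).symm with h1 | h1
  · exact absurd (hw w h1) (G.loopless.irrefl w)
  · exact h1

variable {G}

lemma IsComp.sub {S S' D D' : Set V} (h : IsComp G S D) (h' : IsComp G S' D') (hS : S ⊆ S')
    {a : V} (ha : a ∈ D) (ha' : a ∈ D') : D' ⊆ D := by
  by_contra hcon
  obtain ⟨b, hb, hbD⟩ := Set.not_subset.1 hcon
  obtain ⟨x, hx, y, hy, hxy, hxD, hyD⟩ := h'.2.2.1 (· ∈ D) ⟨a, ha', ha⟩ ⟨b, hb, hbD⟩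
  rcases h.2.2.2 x hxD y hxy with h1 | h1
  · exact hyD h1
  · exact h'.2.1 y hy (hS h1)

lemma IsComp.disj {S D D' : Set V} (h : IsComp G S D) (h' : IsComp G S D') (hne : D ≠ D')
    {a b : V} (ha : a ∈ D) (hb : b ∈ D') : a ≠ b ∧ ¬ G.Adj a b := by
  have key : ∀ c, c ∈ D → c ∈ D' → False := fun c h1 h2 =>
    hne (Set.Subset.antisymm (h'.sub h subset_rfl h2 h1) (h.sub h' subset_rfl h1 h2))
  refine ⟨?_, ?_⟩
  · rintro rfl; exact key _ ha hb
  · intro hab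
    rcases h.2.2.2 a ha b hab with h1 | h1
    · exact key _ h1 hb
    · exact h'.2.1 b hb h1

lemma Bad.mono {D D' : Set V} (h : Bad G D) (hs : D ⊆ D') : Bad G D' := fun w => by
  obtain ⟨d, hd, h2⟩ := h w
  exact ⟨d, hs hd, h2⟩

lemma Bad.edge {D : Set V} (h : Bad G D) (hc : Conn G D) {w d : V} (hd : d ∈ D)
    (hw : G.Adj w d) : ∃ a ∈ D, ∃ b ∈ D, G.Adj a b ∧ G.Adj w a ∧ ¬ G.Adj w b :=
  hc (G.Adj w) ⟨d, hd, hw⟩ (h w)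

lemma p6 (hP6 : IsEmpty (SimpleGraph.pathGraph 6 ↪g G)) {a b c d e f : V}
    (h1 : G.Adj a b) (h2 : G.Adj b c) (h3 : G.Adj c d) (h4 : G.Adj d e) (h5 : G.Adj e f)
    (n1 : ¬ G.Adj a c) (n2 : ¬ G.Adj a d) (n3 : ¬ G.Adj a e) (n4 : ¬ G.Adj a f)
    (n5 : ¬ G.Adj b d) (n6 : ¬ G.Adj b e) (n7 : ¬ G.Adj b f)
    (n8 : ¬ G.Adj c e) (n9 : ¬ G.Adj c f) (n10 : ¬ G.Adj d f) : False := by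
  have adj : ∀ i j : Fin 6, G.Adj (![a, b, c, d, e, f] i) (![a, b, c, d, e, f] j) ↔
      (SimpleGraph.pathGraph 6).Adj i j := by
    intro i j
    rw [SimpleGraph.pathGraph_adj]
    fin_cases i <;> fin_cases j <;> simp [*, G.adj_comm]
  have inj : Function.Injective ![a, b, c, d, e, f] := by
    have tw : ∀ i j : Fin 6, (∀ k, (SimpleGraph.pathGraph 6).Adj i k ↔
      (SimpleGraph.pathGraph 6).Adj j k) → i = j := by
      simp only [SimpleGraph.pathGraph_adj]
      decide
    intro i j hij
    apply tw
    intro k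
    rw [← adj, ← adj, hij]
  exact hP6.false ⟨⟨_, inj⟩, adj _ _⟩

/-- The chain lemma. -/
lemma chain [Fintype V] (hP6 : IsEmpty (SimpleGraph.pathGraph 6 ↪g G)) (v : V) (A : Set V)
    (hA : ∀ a ∈ A, G.Adj v a) (S : Set V) (F : Set (Set V)) (hF : ∀ D ∈ F, IsComp G S D ∧ Bad G D)
    (hv : ∀ D ∈ F, ∀ d ∈ D, ¬ G.Adj v d) (hne : F.Nonempty)
    (hit : ∀ D ∈ F, ∃ a ∈ A, ∃ d ∈ D, G.Adj a d) :
    ∃ a ∈ A, ∀ D ∈ F, ∃ d ∈ D, G.Adj a d := by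
  have hAne : A.Nonempty := by
    obtain ⟨D, hD⟩ := hne
    obtain ⟨a, ha, -⟩ := hit D hD
    exact ⟨a, ha⟩
  obtain ⟨a, ha, hmax⟩ := Set.exists_max_image A
    (fun a => ({D ∈ F | ∃ d ∈ D, G.Adj a d}).ncard) (Set.toFinite _) hAne
  refine ⟨a, ha, ?_⟩
  by_contra hcon
  push Not at hcon
  obtain ⟨D, hD, hDa⟩ := hcon
  obtain ⟨b, hb, d0, hd0, hbd0⟩ := hit D hD
  have : ∃ E ∈ F, (∃ d ∈ E, G.Adj a d) ∧ ∀ d ∈ E, ¬ G.Adj b d := by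
    by_contra hc
    push Not at hc
    have hlt : ({D ∈ F | ∃ d ∈ D, G.Adj a d}).ncard < ({D ∈ F | ∃ d ∈ D, G.Adj b d}).ncard := by
      apply Set.ncard_lt_ncard _ (Set.toFinite _)
      refine ⟨fun E hE => ⟨hE.1, hc E hE.1 hE.2⟩, fun hsub => ?_⟩
      obtain ⟨-, d, hd, had⟩ := hsub ⟨hD, d0, hd0, hbd0⟩
      exact hDa d hd had
    exact absurd (hmax b hb) (not_le.2 hlt)
  obtain ⟨E, hE, ⟨e0, he0, hae0⟩, hbE⟩ := this
  have hDE : D ≠ E := by rintro rfl; exact hDa _ he0 hae0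
  obtain ⟨d, hd, d', hd', hdd', hbd, hbd'⟩ := (hF D hD).2.edge (hF D hD).1.2.2.1 hd0 hbd0
  obtain ⟨e, he, e', he', hee', hae, hae'⟩ := (hF E hE).2.edge (hF E hE).1.2.2.1 he0 hae0
  have dj : ∀ x ∈ D, ∀ y ∈ E, ¬ G.Adj x y := fun x hx y hy =>
    ((hF D hD).1.disj (hF E hE).1 hDE hx hy).2
  by_cases hab : G.Adj b a
  · exact p6 hP6 hdd'.symm hbd.symm hab hae hee' (fun h => hbd' h.symm) (fun h => hDa _ hd' h.symm)
      (dj _ hd' _ he) (dj _ hd' _ he') (fun h => hDa _ hd h.symm) (dj _ hd _ he) (dj _ hd _ he')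
      (hbE _ he) (hbE _ he') hae'
  · exact p6 hP6 hdd'.symm hbd.symm (hA b hb).symm (hA a ha) hae
      (fun h => hbd' h.symm) (fun h => hv D hD _ hd' h.symm) (fun h => hDa _ hd' h.symm)
      (dj _ hd' _ he) (fun h => hv D hD _ hd h.symm) (fun h => hDa _ hd h.symm)
      (dj _ hd _ he) hab (hbE _ he) (hv E hE _ he)

lemma conn_univ (hG : G.Connected) : Conn G Set.univ := by
  apply conn_of_reach
  intro a _ b _
  have := hG.preconnected a b
  rw [SimpleGraph.reachable_iff_reflTransGen] at this
  simpa using this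

end MonP6

open MonP6 in
theorem stmt2 {V : Type*} [Fintype V] (G : SimpleGraph V) (hG : G.Connected)
    (hP6 : IsEmpty (SimpleGraph.pathGraph 6 ↪g G)) (u : V) :
    ∃ X : Set V, u ∈ X ∧ X.ncard ≤ 3 ∧
      (∃ n : ℕ, ∃ hn : 0 < n, n ≤ 3 ∧
        ∃ f : SimpleGraph.pathGraph n ↪g G, Set.range ⇑f = X ∧ f ⟨0, hn⟩ = u) ∧
      Monitor G (closedNbhd G X) := by
  have m1 : ∀ x, x ∈ closedNbhd G {u} ↔ x = u ∨ G.Adj u x := by simp [closedNbhd]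
  by_cases c1 : ∀ D, IsComp G (closedNbhd G {u}) D → ¬ Bad G D
  · refine ⟨{u}, by simp, by simp, ⟨1, by simp, by simp, ⟨⟨fun _ => u, ?_⟩, ?_⟩, ?_, ?_⟩,
      monitor_of G _ c1⟩
    · intro i j _; exact Subsingleton.elim _ _
    · intro i j
      rw [Subsingleton.elim i j]; simp
    · change Set.range (fun _ : Fin 1 => u) = _
      simp
    · rfl
  push Not at c1
  obtain ⟨C0, hC0, hbC0⟩ := c1
  obtain ⟨v, huv, hvhit⟩ := chain hP6 u {a | G.Adj u a} (fun a ha => ha) (closedNbhd G {u})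
    {D | IsComp G (closedNbhd G {u}) D ∧ Bad G D} (fun D hD => hD)
    (fun D hD d hd h => hD.1.2.1 d hd ((m1 d).2 (Or.inr h))) ⟨C0, hC0, hbC0⟩ (by
      rintro D ⟨hD, hb⟩
      obtain ⟨d, hd⟩ := hD.1
      have huD : u ∉ D := fun h => hD.2.1 u h ((m1 u).2 (Or.inl rfl))
      obtain ⟨x, -, y, -, hxy, hx, hy⟩ := conn_univ hG (· ∈ D) ⟨d, trivial, hd⟩ ⟨u, trivial, huD⟩
      have hyS := (hD.2.2.2 x hx y hxy).resolve_left hy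
      rcases (m1 y).1 hyS with rfl | h
      · exact absurd ((m1 x).2 (Or.inr hxy.symm)) (hD.2.1 x hx)
      · exact ⟨y, h, x, hx, hxy.symm⟩)
  replace huv : G.Adj u v := huv
  have m2 : ∀ x, x ∈ closedNbhd G {u, v} ↔ G.Adj u x ∨ G.Adj v x := by
    intro x; simp only [closedNbhd, Set.mem_union, Set.mem_insert_iff, Set.mem_singleton_iff,
      Set.mem_ofPred_eq, exists_eq_or_imp, exists_eq_left]
    constructor
    · rintro ((rfl | rfl) | h)
      · exact Or.inr huv.symm
      · exact Or.inl huv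
      · exact h
    · exact Or.inr
  have s12 : closedNbhd G {u} ⊆ closedNbhd G {u, v} := by
    intro x hx
    rw [m2]
    rcases (m1 x).1 hx with rfl | h
    · exact Or.inr huv.symm
    · exact Or.inl h
  by_cases c2 : ∀ D, IsComp G (closedNbhd G {u, v}) D → ¬ Bad G D
  · refine ⟨{u, v}, by simp, (Set.ncard_insert_le _ _).trans (by simp),
      ⟨2, by simp, by simp, ⟨⟨![u, v], ?_⟩, ?_⟩, ?_, ?_⟩, monitor_of G _ c2⟩
    · intro i j
      have := huv.ne
      have := huv.ne'
      fin_cases i <;> fin_cases j <;> simp_all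
    · intro i j
      rw [SimpleGraph.pathGraph_adj]
      change G.Adj (![u, v] i) (![u, v] j) ↔ _
      have := huv.symm
      fin_cases i <;> fin_cases j <;> simp_all
    · change Set.range ![u, v] = _
      simp [Set.pair_comm]
    · rfl
  push Not at c2
  obtain ⟨D0, hD0, hbD0⟩ := c2
  obtain ⟨d0, hd0⟩ := id hD0.1
  obtain ⟨C, hC, hdC⟩ := exists_comp G (closedNbhd G {u}) d0 (fun h => hD0.2.1 d0 hd0 (s12 h))
  have hDC0 : D0 ⊆ C := hC.sub hD0 s12 hdC hd0
  have hbC : Bad G C := hbD0.mono hDC0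
  -- every bad component below a component of the first level is hit by a neighbor of `v`
  have hit2 : ∀ C D, IsComp G (closedNbhd G {u}) C → IsComp G (closedNbhd G {u, v}) D →
      Bad G D → D ⊆ C → ∃ z ∈ C, G.Adj v z ∧ ∃ d ∈ D, G.Adj z d := by
    intro C D hC hD hb hDC
    obtain ⟨c, hc, hvc⟩ := hvhit C ⟨hC, hb.mono hDC⟩
    obtain ⟨d, hd⟩ := hD.1
    have hcD : c ∉ D := fun h => hD.2.1 c h ((m2 c).2 (Or.inr hvc))
    obtain ⟨x, -, y, hyC, hxy, hx, hy⟩ := hC.2.2.1 (· ∈ D) ⟨d, hDC hd, hd⟩ ⟨c, hc, hcD⟩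
    have hyS := (hD.2.2.2 x hx y hxy).resolve_left hy
    rcases (m2 y).1 hyS with h | h
    · exact absurd ((m1 y).2 (Or.inr h)) (hC.2.1 y hyC)
    · exact ⟨y, hyC, h, x, hx, hxy.symm⟩
  obtain ⟨x, ⟨hvx, hxC⟩, hxhit⟩ := chain hP6 v {a | G.Adj v a ∧ a ∈ C} (fun a ha => ha.1)
    (closedNbhd G {u, v}) {D | (IsComp G (closedNbhd G {u, v}) D ∧ Bad G D) ∧ D ⊆ C}
    (fun D hD => hD.1) (fun D hD d hd h => hD.1.1.2.1 d hd ((m2 d).2 (Or.inr h)))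
    ⟨D0, ⟨hD0, hbD0⟩, hDC0⟩ (by
      rintro D ⟨⟨hD, hb⟩, hDC⟩
      obtain ⟨z, hz, hvz, d, hd, hzd⟩ := hit2 C D hC hD hb hDC
      exact ⟨z, ⟨hvz, hz⟩, d, hd, hzd⟩)
  have hux : ¬ G.Adj u x := fun h => hC.2.1 x hxC ((m1 x).2 (Or.inr h))
  have hxu : x ≠ u := fun h => hC.2.1 x hxC ((m1 x).2 (Or.inl h))
  have m3 : ∀ y, y ∈ closedNbhd G {u, v, x} ↔ G.Adj u y ∨ G.Adj v y ∨ G.Adj x y := by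
    intro y; simp only [closedNbhd, Set.mem_union, Set.mem_insert_iff, Set.mem_singleton_iff,
      Set.mem_ofPred_eq, exists_eq_or_imp, exists_eq_left]
    constructor
    · rintro ((rfl | rfl | rfl) | h)
      · exact Or.inr (Or.inl huv.symm)
      · exact Or.inl huv
      · exact Or.inr (Or.inl hvx)
      · exact h
    · exact Or.inr
  have s23 : closedNbhd G {u, v} ⊆ closedNbhd G {u, v, x} := by
    intro y hy
    rw [m3]
    have := (m2 y).1 hy
    tauto
  refine ⟨{u, v, x}, by simp, ?_, ⟨3, by simp, by simp, ⟨⟨![u, v, x], ?_⟩, ?_⟩, ?_, ?_⟩,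
    monitor_of G _ ?_⟩
  · refine (Set.ncard_insert_le _ _).trans ?_
    have := Set.ncard_insert_le v {x}
    rw [Set.ncard_singleton] at this
    omega
  · intro i j
    have := huv.ne
    have := huv.ne'
    have := hvx.ne
    have := hvx.ne'
    have := hxu.symm
    fin_cases i <;> fin_cases j <;> simp_all
  · intro i j
    rw [SimpleGraph.pathGraph_adj]
    change G.Adj (![u, v, x] i) (![u, v, x] j) ↔ _
    have := huv.symm
    have := hvx.symm
    have : ¬ G.Adj x u := fun h => hux h.symm
    fin_cases i <;> fin_cases j <;> simp_all
  · change Set.range ![u, v, x] = _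
    ext y
    simp [eq_comm]
    tauto
  · rfl
  intro D hD hb
  obtain ⟨d, hd⟩ := id hD.1
  obtain ⟨D', hD', hdD'⟩ := exists_comp G (closedNbhd G {u, v}) d (fun h => hD.2.1 d hd (s23 h))
  obtain ⟨C', hC', hdC'⟩ := exists_comp G (closedNbhd G {u}) d
    (fun h => hD.2.1 d hd (s23 (s12 h)))
  have hDD' : D ⊆ D' := hD'.sub hD s23 hdD' hd
  have hDC' : D' ⊆ C' := hC'.sub hD' s12 hdC' hdD'
  have hb' : Bad G D' := hb.mono hDD'
  have hCC : C' = C := by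
    by_contra hne
    obtain ⟨z, hz, hvz, p, hp, hzp⟩ := hit2 C D0 hC hD0 hbD0 hDC0
    obtain ⟨z', hz', hvz', p', hp', hzp'⟩ := hit2 C' D' hC' hD' hb' hDC'
    obtain ⟨q, hq, r, hr, hqr, hzq, hzr⟩ := hbD0.edge hD0.2.2.1 hp hzp
    have dj : ∀ x ∈ C, ∀ y ∈ C', ¬ G.Adj x y := fun x hx y hy =>
      (hC.disj hC' (Ne.symm hne) hx hy).2
    have nv : ∀ y ∈ D0, ¬ G.Adj y v := fun y hy h =>
      hD0.2.1 y hy ((m2 y).2 (Or.inr h.symm))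
    have nv' : ¬ G.Adj v p' := fun h => hD'.2.1 p' hp' ((m2 p').2 (Or.inr h))
    exact p6 hP6 hqr.symm hzq.symm hvz.symm hvz' hzp' (fun h => hzr h.symm) (nv r hr)
      (dj _ (hDC0 hr) _ hz') (dj _ (hDC0 hr) _ (hDC' hp')) (nv q hq)
      (dj _ (hDC0 hq) _ hz') (dj _ (hDC0 hq) _ (hDC' hp')) (dj _ hz _ hz')
      (dj _ hz _ (hDC' hp')) nv'
  subst hCC
  obtain ⟨y, hy, hxy⟩ := hxhit D' ⟨⟨hD', hb'⟩, hDC'⟩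
  have hyD : y ∉ D := fun h => hD.2.1 y h ((m3 y).2 (Or.inr (Or.inr hxy)))
  obtain ⟨s, -, z, hz, hsz, hs, hzD⟩ := hD'.2.2.1 (· ∈ D) ⟨d, hdD', hd⟩ ⟨y, hy, hyD⟩
  have hzS := (m3 z).1 ((hD.2.2.2 s hs z hsz).resolve_left hzD)
  have hz2 := fun h => hD'.2.1 z hz ((m2 z).2 h)
  have hxz : G.Adj x z := by tauto
  obtain ⟨q, hq, r, hr, hqr, hzq, hzr⟩ := hb.edge hD.2.2.1 hs hsz.symm
  have nq := fun h => hD.2.1 q hq ((m3 q).2 h)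
  have nr := fun h => hD.2.1 r hr ((m3 r).2 h)
  exact p6 hP6 huv hvx hxz hzq hqr hux (by tauto) (by tauto) (by tauto) (by tauto) (by tauto)
    (by tauto) (by tauto) (by tauto) hzr
end

section
/- Let t ∈ {4, 5, 6}, let G be a connected P6-free graph, and let u ∈ V(G) be a vertex such that G contains no induced path on t vertices having u as one of its endpoints. Then there exists a subset X ⊆ V(G) such that u ∈ X, |X| ≤ t − 3, G[X] is an induced path having u as one of its endpoints, and N_G[X] is a monitor in G. -/
theorem path6_aux {V : Type*} {G : SimpleGraph V} {a b c d e f : V}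
    (h1 : G.Adj a b) (h2 : G.Adj b c) (h3 : G.Adj c d) (h4 : G.Adj d e) (h5 : G.Adj e f)
    (n1 : ¬ G.Adj a c) (n2 : ¬ G.Adj a d) (n3 : ¬ G.Adj a e) (n4 : ¬ G.Adj a f)
    (n5 : ¬ G.Adj b d) (n6 : ¬ G.Adj b e) (n7 : ¬ G.Adj b f)
    (n8 : ¬ G.Adj c e) (n9 : ¬ G.Adj c f) (n10 : ¬ G.Adj d f) :
    ∃ g : SimpleGraph.pathGraph 6 ↪g G, g 0 = a := by
  refine ⟨⟨⟨![a, b, c, d, e, f], ?_⟩, ?_⟩, rfl⟩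
  · intro i j hij
    fin_cases i <;> fin_cases j <;> simp at hij ⊢ <;> grind [SimpleGraph.adj_comm, SimpleGraph.irrefl]
  · intro i j
    change G.Adj (![a, b, c, d, e, f] i) (![a, b, c, d, e, f] j) ↔ _
    fin_cases i <;> fin_cases j <;>
      simp [SimpleGraph.pathGraph_adj] <;> grind [SimpleGraph.adj_comm]

theorem path5_aux {V : Type*} {G : SimpleGraph V} {a b c d e : V}
    (h1 : G.Adj a b) (h2 : G.Adj b c) (h3 : G.Adj c d) (h4 : G.Adj d e)
    (n1 : ¬ G.Adj a c) (n2 : ¬ G.Adj a d) (n3 : ¬ G.Adj a e)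
    (n5 : ¬ G.Adj b d) (n6 : ¬ G.Adj b e) (n8 : ¬ G.Adj c e) :
    ∃ g : SimpleGraph.pathGraph 5 ↪g G, g 0 = a := by
  refine ⟨⟨⟨![a, b, c, d, e], ?_⟩, ?_⟩, rfl⟩
  · intro i j hij
    fin_cases i <;> fin_cases j <;> simp at hij ⊢ <;> grind [SimpleGraph.adj_comm, SimpleGraph.irrefl]
  · intro i j
    change G.Adj (![a, b, c, d, e] i) (![a, b, c, d, e] j) ↔ _
    fin_cases i <;> fin_cases j <;>
      simp [SimpleGraph.pathGraph_adj] <;> grind [SimpleGraph.adj_comm]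

theorem path4_aux {V : Type*} {G : SimpleGraph V} {a b c d : V}
    (h1 : G.Adj a b) (h2 : G.Adj b c) (h3 : G.Adj c d)
    (n1 : ¬ G.Adj a c) (n2 : ¬ G.Adj a d) (n5 : ¬ G.Adj b d) :
    ∃ g : SimpleGraph.pathGraph 4 ↪g G, g 0 = a := by
  refine ⟨⟨⟨![a, b, c, d], ?_⟩, ?_⟩, rfl⟩
  · intro i j hij
    fin_cases i <;> fin_cases j <;> simp at hij ⊢ <;> grind [SimpleGraph.adj_comm, SimpleGraph.irrefl]
  · intro i j
    change G.Adj (![a, b, c, d] i) (![a, b, c, d] j) ↔ _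
    fin_cases i <;> fin_cases j <;>
      simp [SimpleGraph.pathGraph_adj] <;> grind [SimpleGraph.adj_comm]

theorem path3_aux {V : Type*} {G : SimpleGraph V} {a b c : V}
    (h1 : G.Adj a b) (h2 : G.Adj b c) (n1 : ¬ G.Adj a c) (hne : a ≠ c) :
    ∃ g : SimpleGraph.pathGraph 3 ↪g G, Set.range g = {a, b, c} ∧ g 0 = a := by
  refine ⟨⟨⟨![a, b, c], ?_⟩, ?_⟩, ?_, rfl⟩
  · intro i j hij
    have := h1.ne
    have := h2.ne
    fin_cases i <;> fin_cases j <;> simp at hij ⊢ <;> simp_all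
  · intro i j
    change G.Adj (![a, b, c] i) (![a, b, c] j) ↔ _
    fin_cases i <;> fin_cases j <;>
      simp [SimpleGraph.pathGraph_adj] <;> grind [SimpleGraph.adj_comm]
  · change Set.range ![a, b, c] = _
    ext x
    simp [eq_comm]
    tauto

theorem path2_aux {V : Type*} {G : SimpleGraph V} {a b : V} (h1 : G.Adj a b) :
    ∃ g : SimpleGraph.pathGraph 2 ↪g G, Set.range g = {a, b} ∧ g 0 = a := by
  refine ⟨⟨⟨![a, b], ?_⟩, ?_⟩, ?_, rfl⟩
  · intro i j hij
    have := h1.ne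
    fin_cases i <;> fin_cases j <;> simp at hij ⊢ <;> simp_all
  · intro i j
    change G.Adj (![a, b] i) (![a, b] j) ↔ _
    fin_cases i <;> fin_cases j <;>
      simp [SimpleGraph.pathGraph_adj] <;> grind [SimpleGraph.adj_comm]
  · change Set.range ![a, b] = _
    ext x
    simp [eq_comm]
    tauto

theorem path1_aux {V : Type*} {G : SimpleGraph V} (a : V) :
    ∃ g : SimpleGraph.pathGraph 1 ↪g G, Set.range g = {a} ∧ g 0 = a := by
  refine ⟨⟨⟨![a], ?_⟩, ?_⟩, ?_, rfl⟩
  · intro i j hij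
    exact Subsingleton.elim _ _
  · intro i j
    change G.Adj (![a] i) (![a] j) ↔ _
    fin_cases i; fin_cases j
    simp
  · change Set.range ![a] = _
    ext x
    simp [eq_comm]

/-- A component that no vertex of `M` dominates. -/
def BadC {V : Type*} (G : SimpleGraph V) (M : Set V)
    (C : (G.induce Mᶜ).ConnectedComponent) : Prop :=
  ¬ ∃ w ∈ M, ∀ v : ↥(Mᶜ), (G.induce Mᶜ).connectedComponentMk v = C → G.Adj w ↑v

/-- `w` has a neighbor in `C`. -/
def Meets {V : Type*} (G : SimpleGraph V) (M : Set V) (w : V)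
    (C : (G.induce Mᶜ).ConnectedComponent) : Prop :=
  ∃ c : ↥(Mᶜ), (G.induce Mᶜ).connectedComponentMk c = C ∧ G.Adj w c

theorem crossing {V : Type*} {H : SimpleGraph V} {a b : V} (h : H.Reachable a b) (S : Set V)
    (ha : a ∉ S) (hb : b ∈ S) : ∃ x y, H.Adj x y ∧ x ∉ S ∧ y ∈ S := by
  obtain ⟨p⟩ := h
  obtain ⟨d, -, h1, h2⟩ := p.exists_boundary_dart Sᶜ ha (by simpa using hb)
  exact ⟨d.fst, d.snd, d.adj, h1, by simpa using h2⟩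

theorem mixed {V : Type*} {G : SimpleGraph V} {M : Set V} {w : V}
    {C : (G.induce Mᶜ).ConnectedComponent} (hb : BadC G M C) (hw : w ∈ M)
    (hm : Meets G M w C) :
    ∃ c d : V, c ∉ M ∧ d ∉ M ∧ Meets G M c C ∧ Meets G M d C ∧ G.Adj w c ∧ G.Adj c d ∧
      ¬ G.Adj w d ∧ (∀ x, ¬ Meets G M x C → ¬ G.Adj x c ∧ ¬ G.Adj x d) ∧
      (∀ C', C' ≠ C → ¬ Meets G M c C' ∧ ¬ Meets G M d C') := by
  obtain ⟨c, hc, hwc⟩ := hm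
  have : ∃ d : ↥(Mᶜ), (G.induce Mᶜ).connectedComponentMk d = C ∧ ¬ G.Adj w d := by
    by_contra! hcon
    exact hb ⟨w, hw, hcon⟩
  obtain ⟨d, hd, hwd⟩ := this
  have hr : (G.induce Mᶜ).Reachable d c := SimpleGraph.ConnectedComponent.exact (hd.trans hc.symm)
  have hr' : (G.induce Mᶜ).Reachable c c := SimpleGraph.Reachable.refl _
  obtain ⟨x, y, hxy, hx, hy⟩ := crossing hr
    {z | (G.induce Mᶜ).connectedComponentMk z = C → G.Adj w z} (by simp [hd, hwd])
    (by simp [hwc])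
  simp only [Set.mem_ofPred_eq, Classical.not_imp] at hx hy
  have hxyG : G.Adj x y := hxy
  have hyC : (G.induce Mᶜ).connectedComponentMk y = C :=
    (SimpleGraph.ConnectedComponent.sound hxy.reachable.symm).trans hx.1
  refine ⟨y, x, y.2, x.2, ⟨x, hx.1, hxyG.symm⟩, ⟨y, hyC, hxyG⟩, hy hyC, hxyG.symm, hx.2, ?_, ?_⟩
  · intro z hz
    exact ⟨fun h => hz ⟨y, hyC, h⟩, fun h => hz ⟨x, hx.1, h⟩⟩
  · intro C' hC'
    constructor
    · rintro ⟨z, hz, h⟩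
      have h' : (G.induce Mᶜ).Adj y z := h
      exact hC' (hz.symm.trans ((SimpleGraph.ConnectedComponent.sound h'.reachable.symm).trans hyC))
    · rintro ⟨z, hz, h⟩
      have h' : (G.induce Mᶜ).Adj x z := h
      exact hC' (hz.symm.trans
        ((SimpleGraph.ConnectedComponent.sound h'.reachable.symm).trans hx.1))

theorem exists_meets_all {V : Type*} [Fintype V] {G : SimpleGraph V}
    (hP6 : IsEmpty (SimpleGraph.pathGraph 6 ↪g G)) {M : Set V} {p : V}
    (hp : ∀ x, G.Adj p x → x ∈ M) (A : Set V) (hAM : A ⊆ M) (hAp : ∀ a ∈ A, G.Adj p a)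
    (hA : ∀ C, BadC G M C → ∃ a ∈ A, Meets G M a C) (hne : ∃ C, BadC G M C) :
    ∃ v ∈ A, ∀ C, BadC G M C → Meets G M v C := by
  classical
  let F : V → Set ((G.induce Mᶜ).ConnectedComponent) := fun v => {C | BadC G M C ∧ Meets G M v C}
  obtain ⟨C0, hC0⟩ := hne
  obtain ⟨a0, ha0, -⟩ := hA C0 hC0
  obtain ⟨v, hvA, hv⟩ := Set.exists_max_image A (fun a => (F a).ncard) (Set.toFinite A) ⟨a0, ha0⟩
  refine ⟨v, hvA, fun C hC => ?_⟩
  by_contra hvC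
  obtain ⟨w, hwA, hwC⟩ := hA C hC
  have : ¬ (F v ⊆ F w) := by
    intro hsub
    have hss : F v ⊂ F w := ⟨hsub, fun h => hvC (h ⟨hC, hwC⟩).2⟩
    have := Set.ncard_lt_ncard hss (Set.toFinite _)
    have := hv w hwA
    omega
  obtain ⟨D, ⟨hD, hvD⟩, hwD⟩ := Set.not_subset.mp this
  have hwD : ¬ Meets G M w D := fun h => hwD ⟨hD, h⟩
  have hCD : C ≠ D := by rintro rfl; exact hvC hvD
  obtain ⟨c, c', hcM, hc'M, mc, mc', wc, cc', wc', hCn, hCo⟩ := mixed hC (hAM hwA) hwC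
  obtain ⟨d, d', hdM, hd'M, md, md', vd, dd', vd', hDn, hDo⟩ := mixed hD (hAM hvA) hvD
  have hpc : ¬ G.Adj p c := fun h => hcM (hp _ h)
  have hpd : ¬ G.Adj p d := fun h => hdM (hp _ h)
  have hpd' : ¬ G.Adj p d' := fun h => hd'M (hp _ h)
  have e1 := hCn v hvC
  have e2 := hDn w hwD
  have e3 := hCn d (hDo C hCD).1
  have e4 := hCn d' (hDo C hCD).2
  have pv := hAp v hvA
  have pw := hAp w hwA
  have s := G.adj_comm
  by_cases hvw : G.Adj v w
  · obtain ⟨g, -⟩ := path6_aux dd'.symm vd.symm hvw wc cc'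
      (by rwa [s]) (by rw [s]; exact e2.2) e4.1 e4.2 (by rw [s]; exact e2.1) e3.1 e3.2
      e1.1 e1.2 wc'
    exact hP6.false g
  · obtain ⟨g, -⟩ := path6_aux dd'.symm vd.symm pv.symm pw wc
      (by rwa [s]) (by rwa [s]) (by rw [s]; exact e2.2) e4.1
      (by rwa [s]) (by rw [s]; exact e2.1) e3.1 hvw e1.1 hpc
    exact hP6.false g

theorem step {V : Type*} {G : SimpleGraph V} {M M' : Set V} (hMM : M ⊆ M') {v : V}
    (hvM : ∀ x, G.Adj v x → x ∈ M')
    (hv : ∀ C, BadC G M C → Meets G M v C) {E : (G.induce M'ᶜ).ConnectedComponent}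
    (hE : BadC G M' E) : ∃ c ∈ M', c ∉ M ∧ Meets G M' c E := by
  obtain ⟨e, rfl⟩ := E.exists_rep
  have heM : (e : V) ∉ M := fun h => e.2 (hMM h)
  let e' : ↥(Mᶜ) := ⟨e, heM⟩
  have hinc : M'ᶜ ⊆ Mᶜ := Set.compl_subset_compl.mpr hMM
  have hbad : BadC G M ((G.induce Mᶜ).connectedComponentMk e') := by
    rintro ⟨w, hw, h⟩
    refine hE ⟨w, hMM hw, fun x hx => ?_⟩
    have hr : (G.induce M'ᶜ).Reachable x e := SimpleGraph.ConnectedComponent.exact hx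
    have := hr.map (SimpleGraph.induceHomOfLE G hinc).toHom
    exact h ⟨x, hinc x.2⟩ (SimpleGraph.ConnectedComponent.sound this)
  obtain ⟨s, hs, hvs⟩ := hv _ hbad
  have hr : (G.induce Mᶜ).Reachable s e' := SimpleGraph.ConnectedComponent.exact hs
  obtain ⟨x, y, hxy, hx, hy⟩ := crossing hr
    {z | ∃ h : (z : V) ∉ M', (G.induce M'ᶜ).connectedComponentMk ⟨z, h⟩ =
      (G.induce M'ᶜ).connectedComponentMk e}
    (fun ⟨h, _⟩ => h (hvM _ hvs)) ⟨e.2, rfl⟩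
  obtain ⟨hyM, hyE⟩ := hy
  have hxyG : G.Adj x y := hxy
  refine ⟨x, ?_, x.2, ⟨y, hyM⟩, hyE, hxyG⟩
  by_contra hxM
  refine hx ⟨hxM, ?_⟩
  rw [← hyE]
  apply SimpleGraph.ConnectedComponent.sound
  exact SimpleGraph.Adj.reachable (G := G.induce M'ᶜ) (u := ⟨x, hxM⟩) (v := ⟨y, hyM⟩) hxyG

theorem start {V : Type*} {G : SimpleGraph V} (hG : G.Connected) {M : Set V} {u : V}
    (hu : u ∈ M) (E : (G.induce Mᶜ).ConnectedComponent) : ∃ c ∈ M, Meets G M c E := by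
  obtain ⟨e, rfl⟩ := E.exists_rep
  obtain ⟨x, y, hxy, hx, hy⟩ := crossing (hG.preconnected u e)
    {z | ∃ h : z ∉ M, (G.induce Mᶜ).connectedComponentMk ⟨z, h⟩ =
      (G.induce Mᶜ).connectedComponentMk e}
    (fun ⟨h, _⟩ => h hu) ⟨e.2, rfl⟩
  obtain ⟨hyM, hyE⟩ := hy
  refine ⟨x, ?_, ⟨y, hyM⟩, hyE, hxy⟩
  by_contra hxM
  refine hx ⟨hxM, ?_⟩
  rw [← hyE]
  apply SimpleGraph.ConnectedComponent.sound
  exact SimpleGraph.Adj.reachable (G := G.induce Mᶜ) (u := ⟨x, hxM⟩) (v := ⟨y, hyM⟩) hxy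

theorem monitor_or {V : Type*} (G : SimpleGraph V) (M : Set V) :
    Monitor G M ∨ ∃ C, BadC G M C := by
  by_cases h : Monitor G M
  · exact Or.inl h
  · right
    simpa [Monitor, BadC] using h

theorem stmt3 {V : Type*} [Fintype V] (t : ℕ) (ht : t = 4 ∨ t = 5 ∨ t = 6)
    (G : SimpleGraph V) (hG : G.Connected)
    (hP6 : IsEmpty (SimpleGraph.pathGraph 6 ↪g G)) (u : V)
    (hu : ¬ ∃ f : SimpleGraph.pathGraph t ↪g G, f ⟨0, by omega⟩ = u) :
    ∃ X : Set V, u ∈ X ∧ X.ncard ≤ t - 3 ∧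
      (∃ n : ℕ, ∃ hn : 0 < n, n ≤ t - 3 ∧
        ∃ f : SimpleGraph.pathGraph n ↪g G, Set.range ⇑f = X ∧ f ⟨0, hn⟩ = u) ∧
      Monitor G (closedNbhd G X) := by
  have s := G.adj_comm
  -- first neighborhood
  rcases monitor_or G (closedNbhd G {u}) with h1 | h1
  · refine ⟨{u}, rfl, ?_, ⟨1, one_pos, by omega, path1_aux u⟩, h1⟩
    rw [Set.ncard_singleton]; omega
  have hadj1 : ∀ x, G.Adj u x → x ∈ closedNbhd G {u} := fun x h => Or.inr ⟨u, rfl, h⟩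
  have hA1 : ∀ C, BadC G (closedNbhd G {u}) C →
      ∃ a ∈ G.neighborSet u, Meets G (closedNbhd G {u}) a C := by
    intro C _
    obtain ⟨c, hc, hcC⟩ := start hG (M := closedNbhd G {u}) (u := u) (Or.inl rfl) C
    refine ⟨c, ?_, hcC⟩
    rcases hc with rfl | ⟨x, rfl, hx⟩
    · obtain ⟨e, -, h⟩ := hcC
      exact absurd (hadj1 _ h) e.2
    · exact hx
  obtain rfl | ht' := ht
  · exfalso
    obtain ⟨C, hC⟩ := h1
    obtain ⟨a, ha, hm⟩ := hA1 C hC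
    obtain ⟨c, d, hc, hd, -, -, ac, cd, ad, -⟩ := mixed hC (hadj1 a ha) hm
    exact hu (path4_aux ha ac cd (fun h => hc (hadj1 _ h)) (fun h => hd (hadj1 _ h)) ad)
  obtain ⟨v, hv, hvall⟩ := exists_meets_all hP6 hadj1 (G.neighborSet u)
    (fun x hx => hadj1 x hx) (fun a h => h) hA1 h1
  have hv : G.Adj u v := hv
  -- second neighborhood
  rcases monitor_or G (closedNbhd G {u, v}) with h2 | h2
  · refine ⟨{u, v}, by simp, ?_, ⟨2, two_pos, by omega, path2_aux hv⟩, h2⟩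
    have := Set.ncard_insert_le u {v}
    rw [Set.ncard_singleton] at this; omega
  have hsub2 : closedNbhd G {u} ⊆ closedNbhd G {u, v} := by
    rintro x (rfl | ⟨y, rfl, h⟩)
    · left; simp
    · right; exact ⟨y, by simp, h⟩
  have hadj2 : ∀ x, G.Adj v x → x ∈ closedNbhd G {u, v} := fun x h => Or.inr ⟨v, by simp, h⟩
  have hdiff2 : ∀ x ∈ closedNbhd G {u, v}, x ∉ closedNbhd G {u} → G.Adj v x := by
    rintro x (h | ⟨y, (rfl | rfl), h⟩) hx
    · rcases h with rfl | rfl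
      · exact absurd (Or.inl rfl) hx
      · exact absurd (hadj1 _ hv) hx
    · exact absurd (hadj1 _ h) hx
    · exact h
  have hA2 : ∀ C, BadC G (closedNbhd G {u, v}) C →
      ∃ a ∈ closedNbhd G {u, v} \ closedNbhd G {u}, Meets G (closedNbhd G {u, v}) a C := by
    intro C hC
    obtain ⟨c, h1, h2, h3⟩ := step hsub2 hadj2 hvall hC
    exact ⟨c, ⟨h1, h2⟩, h3⟩
  obtain rfl | rfl := ht'
  · exfalso
    obtain ⟨C, hC⟩ := h2
    obtain ⟨a, ha, hm⟩ := hA2 C hC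
    obtain ⟨c, d, hc, hd, -, -, ac, cd, ad, -⟩ := mixed hC ha.1 hm
    exact hu (path5_aux hv (hdiff2 _ ha.1 ha.2) ac cd (fun h => ha.2 (hadj1 _ h))
      (fun h => hc (hsub2 (hadj1 _ h))) (fun h => hd (hsub2 (hadj1 _ h)))
      (fun h => hc (hadj2 _ h)) (fun h => hd (hadj2 _ h)) ad)
  obtain ⟨x, hx, hxall⟩ := exists_meets_all hP6 hadj2 (closedNbhd G {u, v} \ closedNbhd G {u})
    (fun x hx => hx.1) (fun a h => hdiff2 a h.1 h.2) hA2 h2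
  have hvx := hdiff2 x hx.1 hx.2
  have hux : ¬ G.Adj u x := fun h => hx.2 (hadj1 _ h)
  have hne : u ≠ x := by rintro rfl; exact hx.2 (Or.inl rfl)
  -- third neighborhood
  rcases monitor_or G (closedNbhd G {u, v, x}) with h3 | h3
  · refine ⟨{u, v, x}, by simp, ?_, ⟨3, three_pos, by omega, path3_aux hv hvx hux hne⟩, h3⟩
    have := Set.ncard_insert_le u {v, x}
    have := Set.ncard_insert_le v {x}
    rw [Set.ncard_singleton] at this; omega
  exfalso
  have hsub3 : closedNbhd G {u, v} ⊆ closedNbhd G {u, v, x} := by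
    rintro z (h | ⟨y, h, h'⟩)
    · left; rcases h with rfl | rfl <;> simp
    · right; exact ⟨y, by rcases h with rfl | rfl <;> simp, h'⟩
  have hadj3 : ∀ z, G.Adj x z → z ∈ closedNbhd G {u, v, x} := fun z h => Or.inr ⟨x, by simp, h⟩
  obtain ⟨C, hC⟩ := h3
  obtain ⟨a, ha, ha', hm⟩ := step hsub3 hadj3 hxall hC
  have hua : ¬ G.Adj u a := fun h => ha' (hsub2 (hadj1 _ h))
  have hva : ¬ G.Adj v a := fun h => ha' (hadj2 _ h)
  have hxa : G.Adj x a := by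
    rcases ha with h | ⟨y, h, h'⟩
    · rcases h with rfl | rfl | rfl
      · exact absurd (Or.inl (by simp)) ha'
      · exact absurd (Or.inl (by simp)) ha'
      · exact absurd hx.1 ha'
    · rcases h with rfl | rfl | rfl
      · exact absurd h' hua
      · exact absurd h' hva
      · exact h'
  obtain ⟨c, d, hc, hd, -, -, ac, cd, ad, -⟩ := mixed hC ha hm
  exact hu (path6_aux hv hvx hxa ac cd hux hua
    (fun h => hc (hsub3 (hsub2 (hadj1 _ h)))) (fun h => hd (hsub3 (hsub2 (hadj1 _ h))))
    hva (fun h => hc (hsub3 (hadj2 _ h))) (fun h => hd (hsub3 (hadj2 _ h)))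
    (fun h => hc (hadj3 _ h)) (fun h => hd (hadj3 _ h)) ad)
end

section
/- Let G be a connected P6-free graph and let u ∈ V(G) be a vertex such that G contains no induced path on 4 vertices having u as one of its endpoints. Then the closed neighborhood N_G[u] is a monitor in G. -/
/-- If `G` is a connected `P₆`-free graph and `u` is a vertex such that
`G` has no induced `P₄` with endpoint `u`, then `N_G[u]` is a monitor in `G`. -/
theorem stmt4 {V : Type*} [Fintype V] (G : SimpleGraph V) (hG : G.Connected)
    (hP6 : IsEmpty (SimpleGraph.pathGraph 6 ↪g G)) (u : V)
    (hu : ¬ ∃ f : SimpleGraph.pathGraph 4 ↪g G, f 0 = u) :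
    Monitor G (closedNbhd G {u}) := by
  classical
  generalize hM : closedNbhd G {u} = M
  intro C
  induction C using SimpleGraph.ConnectedComponent.ind with | _ c => ?_
  have hmem : ∀ v, v ∈ M ↔ v = u ∨ G.Adj u v := by
    intro v; simp [← hM, closedNbhd]
  have key : ∀ w x y, G.Adj u w → x ∉ M → y ∉ M → G.Adj w x → G.Adj x y → G.Adj w y := by
    intro w x y huw hx hy hwx hxy
    by_contra hwy
    rw [hmem] at hx hy
    push Not at hx hy
    obtain ⟨hxu, hux⟩ := hx
    obtain ⟨hyu, huy⟩ := hy
    apply hu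
    have h1 := huw.ne
    have h2 := hwx.ne
    have h3 := hxy.ne
    have h4 : w ≠ y := fun h => huy (h ▸ huw)
    have hux' : ¬ G.Adj x u := fun h => hux h.symm
    have huy' : ¬ G.Adj y u := fun h => huy h.symm
    have hwy' : ¬ G.Adj y w := fun h => hwy h.symm
    refine ⟨⟨⟨![u, w, x, y], ?_⟩, ?_⟩, rfl⟩
    · intro a b hab
      fin_cases a <;> fin_cases b <;> simp_all
    · intro a b
      change G.Adj (![u, w, x, y] a) (![u, w, x, y] b) ↔ _
      fin_cases a <;> fin_cases b <;>
        simp [SimpleGraph.pathGraph_adj, *, huw.symm, hwx.symm, hxy.symm]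
  obtain ⟨p⟩ := hG.preconnected c.1 u
  obtain ⟨d, -, ⟨hd1, hd1'⟩, hd2⟩ := p.exists_boundary_dart
    {v | ∃ h : v ∈ Mᶜ, (G.induce Mᶜ).Reachable ⟨v, h⟩ c}
    ⟨c.2, SimpleGraph.Reachable.refl _⟩
    (by rintro ⟨h, -⟩; exact h ((hmem u).2 (Or.inl rfl)))
  have hwM : d.snd ∈ M := by
    by_contra h
    refine hd2 ⟨h, SimpleGraph.Reachable.trans (SimpleGraph.Adj.reachable ?_) hd1'⟩
    exact d.adj.symm
  have huw : G.Adj u d.snd := by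
    rcases (hmem _).1 hwM with h | h
    · exact absurd ((hmem d.fst).2 (Or.inr (h ▸ d.adj.symm))) hd1
    · exact h
  refine ⟨d.snd, hwM, fun v hv => ?_⟩
  by_contra hnv
  obtain ⟨q⟩ := hd1'.trans (SimpleGraph.ConnectedComponent.exact hv).symm
  obtain ⟨e, -, he1, he2⟩ := q.exists_boundary_dart {z | G.Adj d.snd z.1} d.adj.symm hnv
  exact he2 (key _ _ _ huw e.fst.2 e.snd.2 he1 e.adj)
end

section
/- Let G be a connected graph and let X ⊆ X′ ⊆ V(G). If N_G[X] is a monitor in G, then N_G[X′] is also a monitor in G. -/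
/-- If `G` is connected, `X ⊆ X′` and `N_G[X]` is a monitor in `G`,
then `N_G[X′]` is a monitor in `G` as well. -/
theorem stmt5 {V : Type*} [Fintype V] (G : SimpleGraph V) (hG : G.Connected)
    (X X' : Set V) (hXX' : X ⊆ X') (hmon : Monitor G (closedNbhd G X)) :
    Monitor G (closedNbhd G X') := by
  have hsub : closedNbhd G X ⊆ closedNbhd G X' := by
    rintro v (hv | ⟨x, hx, hv⟩)
    · exact Or.inl (hXX' hv)
    · exact Or.inr ⟨x, hXX' hx, hv⟩
  have hc : (closedNbhd G X')ᶜ ⊆ (closedNbhd G X)ᶜ := Set.compl_subset_compl.mpr hsub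
  intro C
  induction C using SimpleGraph.ConnectedComponent.ind with
  | _ u =>
    obtain ⟨w, hw, h⟩ := hmon ((G.induce (closedNbhd G X)ᶜ).connectedComponentMk ⟨u, hc u.2⟩)
    refine ⟨w, hsub hw, fun v hv => h ⟨v, hc v.2⟩ ?_⟩
    rw [SimpleGraph.ConnectedComponent.eq] at hv ⊢
    exact hv.map (SimpleGraph.induceHomOfLE G hc).toHom
end

section
/- For every integer n ≥ 2, let G_n be the graph obtained from the disjoint union of n+1 complete graphs K^(0), K^(1), …, K^(n), each on n vertices, by choosing one vertex m_i in each K^(i) for 1 ≤ i ≤ n and n pairwise distinct vertices c_1, …, c_n in K^(0), and adding the edges m_i c_i for 1 ≤ i ≤ n. Then G_n contains no induced path on 7 vertices, and every set X ⊆ V(G_n) such that N_{G_n}[X] intersects every maximum-size clique of G_n satisfies |X| ≥ n. -/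
/-- The graph `G_n`: the disjoint union of `n+1` complete graphs
`K⁽⁰⁾, K⁽¹⁾, …, K⁽ⁿ⁾`, each on `n` vertices (block `i` consists of the vertices with
first coordinate `i`), together with, for each `1 ≤ i ≤ n`, an edge joining the vertex
`m_i = (i, i')` of `K⁽ⁱ⁾` to the vertex `c_i = (0, i')` of `K⁽⁰⁾` (the vertices
`c_1, …, c_n` being pairwise distinct). -/
def exGraph (n : ℕ) : SimpleGraph (Fin (n + 1) × Fin n) :=
  SimpleGraph.fromRel (fun p q =>
    p.1 = q.1 ∨ ∃ i : Fin n, p = (Fin.succ i, i) ∧ q = ((0 : Fin (n + 1)), i))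

theorem exGraph_adj {n : ℕ} (p q : Fin (n + 1) × Fin n) :
    (exGraph n).Adj p q ↔ p ≠ q ∧ (p.1 = q.1 ∨ (∃ i : Fin n, p = (Fin.succ i, i) ∧ q = (0, i)) ∨
      ∃ i : Fin n, q = (Fin.succ i, i) ∧ p = (0, i)) := by
  unfold exGraph
  rw [SimpleGraph.fromRel_adj]
  constructor
  · rintro ⟨h, (h1 | h1) | (h1 | h1)⟩
    · exact ⟨h, Or.inl h1⟩
    · exact ⟨h, Or.inr (Or.inl h1)⟩
    · exact ⟨h, Or.inl h1.symm⟩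
    · exact ⟨h, Or.inr (Or.inr h1)⟩
  · rintro ⟨h, h1 | h1 | h1⟩
    · exact ⟨h, Or.inl (Or.inl h1)⟩
    · exact ⟨h, Or.inl (Or.inr h1)⟩
    · exact ⟨h, Or.inr (Or.inr h1)⟩

/-- An edge between different blocks has an end in block 0. -/
theorem exGraph_cross {n : ℕ} {p q : Fin (n + 1) × Fin n} (h : (exGraph n).Adj p q) :
    p.1 = q.1 ∨ p.1 = 0 ∨ q.1 = 0 := by
  rw [exGraph_adj] at h
  rcases h with ⟨-, h | ⟨i, h1, h2⟩ | ⟨i, h1, h2⟩⟩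
  · exact Or.inl h
  · subst h2; simp
  · subst h2; simp

theorem exGraph_noP7 (n : ℕ) : IsEmpty (SimpleGraph.pathGraph 7 ↪g exGraph n) := by
  constructor
  intro f
  have hs : ∀ a b : Fin 7, a ≠ b → (f a).1 = (f b).1 → a.val + 1 = b.val ∨ b.val + 1 = a.val := by
    intro a b hab h
    have : (exGraph n).Adj (f a) (f b) :=
      (exGraph_adj _ _).2 ⟨fun e => hab (f.injective e), Or.inl h⟩
    rw [f.map_adj_iff, SimpleGraph.pathGraph_adj] at this
    exact this
  have hc : ∀ a b : Fin 7, a.val + 1 = b.val → (f a).1 = (f b).1 ∨ (f a).1 = 0 ∨ (f b).1 = 0 := by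
    intro a b hab
    apply exGraph_cross
    rw [f.map_adj_iff, SimpleGraph.pathGraph_adj]
    exact Or.inl hab
  have key : ∀ a b c : Fin 7, a.val + 1 = b.val → b.val + 1 = c.val →
      ∃ d : Fin 7, (f d).1 = 0 ∧ a ≤ d ∧ d ≤ c := by
    intro a b c h1 h2
    by_contra hcon
    push Not at hcon
    have ha : (f a).1 ≠ 0 := fun h => absurd (hcon a h le_rfl) (by rw [Fin.lt_def]; omega)
    have hb : (f b).1 ≠ 0 := fun h =>
      absurd (hcon b h (by rw [Fin.le_def]; omega)) (by rw [Fin.lt_def]; omega)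
    have hc' : (f c).1 ≠ 0 := fun h =>
      absurd (hcon c h (by rw [Fin.le_def]; omega)) (by simp)
    have e1 : (f a).1 = (f b).1 := by have := hc a b h1; tauto
    have e2 : (f b).1 = (f c).1 := by have := hc b c h2; tauto
    have := hs a c (by rintro rfl; omega) (e1.trans e2)
    omega
  obtain ⟨d, hd, -, hd2⟩ := key 0 1 2 rfl rfl
  obtain ⟨e, he, he1, -⟩ := key 4 5 6 rfl rfl
  have hd2' : d.val ≤ 2 := hd2
  have he1' : 4 ≤ e.val := he1
  have := hs d e (by rintro rfl; omega) (hd.trans he.symm)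
  omega

theorem exGraph_clique_card {n : ℕ} (hn : 2 ≤ n) (K : Finset (Fin (n + 1) × Fin n))
    (hK : (exGraph n).IsClique ↑K) : K.card ≤ n := by
  by_cases hinj : Set.InjOn Prod.snd (K : Set (Fin (n + 1) × Fin n))
  · calc K.card = (K.image Prod.snd).card := (Finset.card_image_of_injOn hinj).symm
      _ ≤ n := by simpa using Finset.card_le_univ (K.image Prod.snd)
  · have hex : ∃ i : Fin n, (Fin.succ i, i) ∈ K ∧ ((0 : Fin (n + 1)), i) ∈ K := by
      unfold Set.InjOn at hinj
      push Not at hinj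
      obtain ⟨p, hp, q, hq, h, hne⟩ := hinj
      have := (exGraph_adj _ _).1 (hK hp hq hne)
      rcases this with ⟨-, h1 | ⟨i, rfl, rfl⟩ | ⟨i, rfl, rfl⟩⟩
      · exact absurd (Prod.ext h1 h) hne
      · exact ⟨i, hp, hq⟩
      · exact ⟨i, hq, hp⟩
    obtain ⟨i, hp, hq⟩ := hex
    have hsub : K ⊆ {(Fin.succ i, i), ((0 : Fin (n + 1)), i)} := by
      rintro ⟨a, b⟩ hr
      by_contra hcon
      simp only [Finset.mem_insert, Finset.mem_singleton, not_or] at hcon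
      have h1 := (exGraph_adj _ _).1 (hK hr hp hcon.1)
      have h2 := (exGraph_adj _ _).1 (hK hr hq hcon.2)
      simp only [Prod.mk.injEq, Fin.succ_ne_zero] at h1 h2 hcon
      rcases h1 with ⟨-, h1 | ⟨j, h1, h1'⟩ | ⟨j, h1, h1'⟩⟩
      · subst h1
        rcases h2 with ⟨-, h2 | ⟨j, h2, h2'⟩ | ⟨j, h2, h2'⟩⟩
        · exact Fin.succ_ne_zero _ h2
        · exact hcon.1 ⟨rfl, by rw [h2.2, h2'.2]⟩
        · exact Fin.succ_ne_zero _ h2.1.symm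
      · exact h1'.1
      · exact hcon.2 ⟨h1'.1, by rw [h1'.2, h1.2]⟩
    exact (Finset.card_le_card hsub).trans (Finset.card_le_two.trans hn)

/-- The vertex set of block `i`. -/
def exBlock (n : ℕ) (i : Fin (n + 1)) : Finset (Fin (n + 1) × Fin n) :=
  {i} ×ˢ Finset.univ

theorem exBlock_card (n : ℕ) (i : Fin (n + 1)) : (exBlock n i).card = n := by
  simp [exBlock]

theorem exBlock_clique (n : ℕ) (i : Fin (n + 1)) :
    (exGraph n).IsClique ↑(exBlock n i) := by
  intro p hp q hq hne
  have hp := (Finset.mem_singleton.1 (Finset.mem_product.1 (Finset.mem_coe.1 hp)).1)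
  have hq := (Finset.mem_singleton.1 (Finset.mem_product.1 (Finset.mem_coe.1 hq)).1)
  exact (exGraph_adj _ _).2 ⟨hne, Or.inl (by rw [hp, hq])⟩

theorem exGraph_cliqueNum {n : ℕ} (hn : 2 ≤ n) : (exGraph n).cliqueNum = n := by
  apply le_antisymm
  · obtain ⟨s, hs⟩ := (exGraph n).exists_isNClique_cliqueNum
    rw [← hs.card_eq]
    exact exGraph_clique_card hn s hs.isClique
  · have := (exBlock_clique n 0).card_le_cliqueNum
    rwa [exBlock_card] at this

theorem stmt6 (n : ℕ) (hn : 2 ≤ n) :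
    IsEmpty (SimpleGraph.pathGraph 7 ↪g exGraph n) ∧
      ∀ X : Finset (Fin (n + 1) × Fin n),
        (∀ K : Finset (Fin (n + 1) × Fin n),
          (exGraph n).IsClique ↑K → K.card = (exGraph n).cliqueNum →
            ∃ v ∈ K, v ∈ closedNbhd (exGraph n) ↑X) →
        n ≤ X.card := by
  refine ⟨exGraph_noP7 n, fun X hX => ?_⟩
  let f : Fin (n + 1) × Fin n → Fin n := fun p => Fin.cases p.2 (fun j => j) p.1
  have hf : ∀ i : Fin n, i ∈ X.image f := by
    intro i
    rw [Finset.mem_image]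
    obtain ⟨v, hv, hvX⟩ := hX (exBlock n i.succ) (exBlock_clique n _)
      (by rw [exBlock_card, exGraph_cliqueNum hn])
    have hv1 : v.1 = i.succ := Finset.mem_singleton.1 (Finset.mem_product.1 hv).1
    rcases hvX with h | ⟨x, hx, hadj⟩
    · exact ⟨v, h, by simp [f, hv1]⟩
    · refine ⟨x, hx, ?_⟩
      rcases (exGraph_adj _ _).1 hadj with ⟨-, h | ⟨j, h1, h2⟩ | ⟨j, h1, h2⟩⟩
      · simp [f, h, hv1]
      · rw [h2] at hv1
        exact absurd hv1.symm (Fin.succ_ne_zero _)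
      · rw [h1] at hv1
        rw [h2]
        simpa [f] using hv1
  have : X.image f = Finset.univ := Finset.eq_univ_iff_forall.2 hf
  calc n = (X.image f).card := by rw [this]; simp
    _ ≤ X.card := Finset.card_image_le
end

section
/- Let s, t ≥ 1 be integers and let G be a graph containing no induced copy of L_s and no induced copy of S_t. Let x ∈ V(G), let I ⊆ N(x) be an independent set of neighbors of x, and let B ⊆ V(G) \ N[x] be a set of non-neighbors of x. Then there exists a set S ⊆ I with |S| < C(s+t−2, s−1) (a binomial coefficient) such that every vertex b ∈ B that has a neighbor in I also has a neighbor in S. -/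
/-- `S_t`: the star `K_{1,t}` with every edge subdivided once.  The center is
`Sum.inl ()`, the middle vertices are `Sum.inr (Sum.inl i)` and the leaves are
`Sum.inr (Sum.inr i)`. -/
def subStar (t : ℕ) : SimpleGraph (Unit ⊕ Fin t ⊕ Fin t) :=
  SimpleGraph.fromRel (fun a b =>
    (∃ i, a = Sum.inl () ∧ b = Sum.inr (Sum.inl i)) ∨
    (∃ i, a = Sum.inr (Sum.inl i) ∧ b = Sum.inr (Sum.inr i)))

/-- `L_s`: obtained from `S_s` by making the `s` leaves pairwise adjacent. -/
def lGraph (s : ℕ) : SimpleGraph (Unit ⊕ Fin s ⊕ Fin s) :=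
  SimpleGraph.fromRel (fun a b =>
    (∃ i, a = Sum.inl () ∧ b = Sum.inr (Sum.inl i)) ∨
    (∃ i, a = Sum.inr (Sum.inl i) ∧ b = Sum.inr (Sum.inr i)) ∨
    (∃ i j, a = Sum.inr (Sum.inr i) ∧ b = Sum.inr (Sum.inr j)))

theorem ramseyAux {V : Type*} (r : V → V → Prop) (hr : ∀ a b, r a b → r b a) :
    ∀ (n p q : ℕ), p + q = n → ∀ A : Finset V, (p + q).choose p ≤ A.card →
      (∃ T ⊆ A, T.card = p + 1 ∧ ∀ a ∈ T, ∀ b ∈ T, a ≠ b → r a b) ∨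
      (∃ T ⊆ A, T.card = q + 1 ∧ ∀ a ∈ T, ∀ b ∈ T, a ≠ b → ¬ r a b) := by
  classical
  intro n
  induction n with
  | zero =>
    intro p q h A hA
    obtain ⟨rfl, rfl⟩ : p = 0 ∧ q = 0 := by omega
    obtain ⟨v, hv⟩ := Finset.card_pos.1 (show 0 < A.card by simpa using hA)
    left
    exact ⟨{v}, by simpa using hv, by simp, by simp⟩
  | succ n ih =>
    intro p q h A hA
    have hpos : 0 < A.card := lt_of_lt_of_le (Nat.choose_pos (by omega)) hA
    obtain ⟨v, hv⟩ := Finset.card_pos.1 hpos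
    rcases p with _ | p
    · left
      exact ⟨{v}, by simpa using hv, by simp, by simp⟩
    rcases q with _ | q
    · right
      exact ⟨{v}, by simpa using hv, by simp, by simp⟩
    have hsplit := Finset.card_filter_add_card_filter_not (s := A.erase v) (fun a => r v a)
    have hc := Finset.card_erase_of_mem hv
    have hch : (p + 1 + (q + 1)).choose (p + 1)
        = (p + (q + 1)).choose p + (p + 1 + q).choose (p + 1) := by
      rw [show p + 1 + (q + 1) = (p + q + 1) + 1 by ring, Nat.choose_succ_succ,
        show p + (q + 1) = p + q + 1 by ring, show p + 1 + q = p + q + 1 by ring]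
    by_cases hN : (p + (q + 1)).choose p ≤ ((A.erase v).filter (fun a => r v a)).card
    · rcases ih p (q + 1) (by omega) _ hN with ⟨T, hT, hcard, hcl⟩ | ⟨T, hT, hcard, hcl⟩
      · left
        have hvT : v ∉ T := fun h => by simpa using hT h
        have hTr : ∀ a ∈ T, r v a := fun a ha => (Finset.mem_filter.1 (hT ha)).2
        refine ⟨insert v T, ?_, by rw [Finset.card_insert_of_notMem hvT, hcard], ?_⟩
        · intro a ha
          rcases Finset.mem_insert.1 ha with rfl | ha
          · exact hv
          · exact Finset.mem_of_mem_erase (Finset.mem_filter.1 (hT ha)).1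
        · intro a ha b hb hab
          rcases Finset.mem_insert.1 ha with rfl | hat <;>
            rcases Finset.mem_insert.1 hb with rfl | hbt
          · exact absurd rfl hab
          · exact hTr b hbt
          · exact hr _ _ (hTr a hat)
          · exact hcl a hat b hbt hab
      · right
        exact ⟨T, fun a ha => Finset.mem_of_mem_erase (Finset.mem_filter.1 (hT ha)).1, hcard, hcl⟩
    · have hM : (p + 1 + q).choose (p + 1) ≤ ((A.erase v).filter (fun a => ¬ r v a)).card := by
        omega
      rcases ih (p + 1) q (by omega) _ hM with ⟨T, hT, hcard, hcl⟩ | ⟨T, hT, hcard, hcl⟩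
      · left
        exact ⟨T, fun a ha => Finset.mem_of_mem_erase (Finset.mem_filter.1 (hT ha)).1, hcard, hcl⟩
      · right
        have hvT : v ∉ T := fun h => by simpa using hT h
        have hTr : ∀ a ∈ T, ¬ r v a := fun a ha => (Finset.mem_filter.1 (hT ha)).2
        refine ⟨insert v T, ?_, by rw [Finset.card_insert_of_notMem hvT, hcard], ?_⟩
        · intro a ha
          rcases Finset.mem_insert.1 ha with rfl | ha
          · exact hv
          · exact Finset.mem_of_mem_erase (Finset.mem_filter.1 (hT ha)).1
        · intro a ha b hb hab
          rcases Finset.mem_insert.1 ha with rfl | hat <;>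
            rcases Finset.mem_insert.1 hb with rfl | hbt
          · exact absurd rfl hab
          · exact hTr b hbt
          · exact fun h => hTr a hat (hr _ _ h)
          · exact hcl a hat b hbt hab

/-- The embedding map used for both forbidden graphs. -/
def embMap {V : Type*} (n : ℕ) (x : V) (u w : Fin n → V) : Unit ⊕ Fin n ⊕ Fin n → V :=
  Sum.elim (fun _ => x) (Sum.elim u w)

theorem embMap_inj {V : Type*} {n : ℕ} (G : SimpleGraph V) (x : V) (u w : Fin n → V)
    (hu : Function.Injective u) (hxu : ∀ i, G.Adj x (u i))
    (hxw : ∀ i, w i ≠ x ∧ ¬ G.Adj x (w i)) (huw : ∀ i j, G.Adj (u i) (w j) ↔ i = j) :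
    Function.Injective (embMap n x u w) := by
  rintro (a | i | i) (b | j | j) h <;>
    simp only [embMap, Sum.elim_inl, Sum.elim_inr] at h
  · rfl
  · have := hxu j
    rw [← h] at this
    exact absurd this G.irrefl
  · exact absurd h.symm (hxw j).1
  · have := hxu i
    rw [h] at this
    exact absurd this G.irrefl
  · rw [hu h]
  · exact absurd (h ▸ hxu i) (hxw j).2
  · exact absurd h (hxw i).1
  · exact absurd (h.symm ▸ hxu j) (hxw i).2
  · have : G.Adj (u i) (w j) := h ▸ (huw i i).2 rfl
    rw [(huw i j).1 this]

theorem emb_lGraph {V : Type*} {n : ℕ} (G : SimpleGraph V) (x : V) (u w : Fin n → V)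
    (hu : Function.Injective u) (hxu : ∀ i, G.Adj x (u i)) (huu : ∀ i j, ¬ G.Adj (u i) (u j))
    (hxw : ∀ i, w i ≠ x ∧ ¬ G.Adj x (w i)) (huw : ∀ i j, G.Adj (u i) (w j) ↔ i = j)
    (hww : ∀ i j, i ≠ j → G.Adj (w i) (w j)) : Nonempty (lGraph n ↪g G) := by
  refine ⟨⟨⟨embMap n x u w, embMap_inj G x u w hu hxu hxw huw⟩, ?_⟩⟩
  have h1 := fun i => (hxu i).symm
  have h2 : ∀ i, ¬ G.Adj (w i) x := fun i (h : G.Adj (w i) x) => (hxw i).2 (G.adj_comm _ _ |>.1 h)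
  have h3 : ∀ i j, G.Adj (w j) (u i) ↔ i = j := fun i j => by rw [G.adj_comm, huw]
  have h4 : ∀ i j, G.Adj (w i) (w j) ↔ i ≠ j :=
    fun i j => ⟨fun h e => G.irrefl (e ▸ h), hww i j⟩
  rintro (a | i | i) (b | j | j) <;>
    simp [embMap, lGraph, hxu, huu, hxw, huw, h1, h2, h3, h4, eq_comm]

theorem emb_subStar {V : Type*} {n : ℕ} (G : SimpleGraph V) (x : V) (u w : Fin n → V)
    (hu : Function.Injective u) (hxu : ∀ i, G.Adj x (u i)) (huu : ∀ i j, ¬ G.Adj (u i) (u j))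
    (hxw : ∀ i, w i ≠ x ∧ ¬ G.Adj x (w i)) (huw : ∀ i j, G.Adj (u i) (w j) ↔ i = j)
    (hww : ∀ i j, i ≠ j → ¬ G.Adj (w i) (w j)) : Nonempty (subStar n ↪g G) := by
  refine ⟨⟨⟨embMap n x u w, embMap_inj G x u w hu hxu hxw huw⟩, ?_⟩⟩
  have h1 := fun i => (hxu i).symm
  have h2 : ∀ i, ¬ G.Adj (w i) x := fun i (h : G.Adj (w i) x) => (hxw i).2 (G.adj_comm _ _ |>.1 h)
  have h3 : ∀ i j, G.Adj (w j) (u i) ↔ i = j := fun i j => by rw [G.adj_comm, huw]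
  have h4 : ∀ i j, ¬ G.Adj (w i) (w j) :=
    fun i j h => hww i j (fun e => G.irrefl (e ▸ h)) h
  rintro (a | i | i) (b | j | j) <;>
    simp [embMap, subStar, hxu, huu, hxw, huw, h1, h2, h3, h4, eq_comm]

/-- If `G` has no induced `L_s` and no induced `S_t`, `x` is a vertex,
`I ⊆ N(x)` is independent and `B ⊆ V(G) \ N[x]`, then there is `S ⊆ I` with
`|S| < C(s+t−2, s−1)` dominating all vertices of `B` having a neighbor in `I`. -/
theorem stmt7 {V : Type*} [Fintype V] (s t : ℕ) (hs : 1 ≤ s) (ht : 1 ≤ t)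
    (G : SimpleGraph V)
    (hL : IsEmpty (lGraph s ↪g G)) (hS : IsEmpty (subStar t ↪g G))
    (x : V) (I : Set V) (hIx : ∀ a ∈ I, G.Adj x a)
    (hIindep : ∀ a ∈ I, ∀ b ∈ I, ¬ G.Adj a b)
    (B : Set V) (hB : ∀ b ∈ B, b ≠ x ∧ ¬ G.Adj x b) :
    ∃ S : Finset V, ↑S ⊆ I ∧ S.card < (s + t - 2).choose (s - 1) ∧
      ∀ b ∈ B, (∃ a ∈ I, G.Adj b a) → ∃ a ∈ S, G.Adj b a := by
  classical
  let P : Finset V → Prop := fun S => ↑S ⊆ I ∧ ∀ b ∈ B, (∃ a ∈ I, G.Adj b a) → ∃ a ∈ S, G.Adj b a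
  have hP : P (Finset.univ.filter (· ∈ I)) := by
    refine ⟨by intro a; simp, ?_⟩
    rintro b - ⟨a, ha, hab⟩
    exact ⟨a, by simpa using ha, hab⟩
  obtain ⟨S, hSP, hmin⟩ := WellFounded.has_min
    (InvImage.wf (Finset.card : Finset V → ℕ) Nat.lt_wfRel.wf) {S | P S} ⟨_, hP⟩
  obtain ⟨hSI, hdom⟩ : P S := hSP
  refine ⟨S, hSI, ?_, hdom⟩
  by_contra hcard
  have hpriv : ∀ a ∈ S, ∃ b ∈ B, G.Adj b a ∧ ∀ c ∈ S, G.Adj b c → c = a := by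
    intro a ha
    by_contra hcon
    push Not at hcon
    refine hmin (S.erase a) ⟨fun c hc => hSI (Finset.mem_of_mem_erase hc), ?_⟩
      (Finset.card_erase_lt_of_mem ha)
    intro b hb hbI
    obtain ⟨c, hc, hbc⟩ := hdom b hb hbI
    by_cases hca : c = a
    · subst hca
      obtain ⟨d, hd, hbd, hne⟩ := hcon b hb hbc
      exact ⟨d, Finset.mem_erase.2 ⟨hne, hd⟩, hbd⟩
    · exact ⟨c, Finset.mem_erase.2 ⟨hca, hc⟩, hbc⟩
  choose! f hfB hfa hfu using hpriv
  obtain ⟨p, rfl⟩ : ∃ p, s = p + 1 := ⟨s - 1, by omega⟩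
  obtain ⟨q, rfl⟩ : ∃ q, t = q + 1 := ⟨t - 1, by omega⟩
  rw [show p + 1 + (q + 1) - 2 = p + q by omega, show p + 1 - 1 = p by omega, not_lt] at hcard
  have key : ∀ (n : ℕ) (T : Finset V), T ⊆ S → T.card = n → ∃ u : Fin n → V,
      Function.Injective u ∧ (∀ i, u i ∈ T) ∧ (∀ i, u i ∈ S) := by
    intro n T hT hn
    let e := T.equivFinOfCardEq hn
    exact ⟨fun i => (e.symm i : V), fun i j h => e.symm.injective (Subtype.ext h),
      fun i => (e.symm i).2, fun i => hT (e.symm i).2⟩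
  rcases ramseyAux (fun a b => G.Adj (f a) (f b)) (fun _ _ h => h.symm) _ p q rfl S hcard with
    ⟨T, hT, hn, hcl⟩ | ⟨T, hT, hn, hcl⟩
  all_goals
    obtain ⟨u, hu, huT, huS⟩ := key _ T hT hn
    have huw : ∀ i j, G.Adj (u i) (f (u j)) ↔ i = j := fun i j =>
      ⟨fun h => hu (hfu _ (huS j) _ (huS i) h.symm), fun h => h ▸ (hfa _ (huS i)).symm⟩
  · obtain ⟨g⟩ := emb_lGraph G x u (fun i => f (u i)) hu (fun i => hIx _ (hSI (huS i)))
      (fun i j => hIindep _ (hSI (huS i)) _ (hSI (huS j))) (fun i => hB _ (hfB _ (huS i))) huw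
      (fun i j hij => hcl _ (huT i) _ (huT j) (fun h => hij (hu h)))
    exact hL.false g
  · obtain ⟨g⟩ := emb_subStar G x u (fun i => f (u i)) hu (fun i => hIx _ (hSI (huS i)))
      (fun i j => hIindep _ (hSI (huS i)) _ (hSI (huS j))) (fun i => hB _ (hfB _ (huS i))) huw
      (fun i j hij => hcl _ (huT i) _ (huT j) (fun h => hij (hu h)))
    exact hS.false g
end

section
/- Let G be a connected graph and let x1, x2, x3 be three distinct vertices such that x2 is adjacent to x1, x3 is adjacent to x1 or to x2, and N_G[X] is a monitor in G, where X = {x1, x2, x3}. Define A1 = N(x1) \ X, A2 = N(x2) \ (X ∪ A1), A3 = N(x3) \ (X ∪ A1 ∪ A2), and A4 = V(G) \ N[X]. Let F be a connected graph. Then: (i) if G[A1] contains an induced copy of F, then G contains an induced copy of F⁺; (ii) if G[A_i] contains an induced copy of F for some i ∈ {2, 3, 4}, then G contains an induced copy of F⁺⁺. -/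
/-- `F⁺`: the graph `F` together with a new universal vertex (`none`). -/
def addUniv {W : Type*} (F : SimpleGraph W) : SimpleGraph (Option W) :=
  SimpleGraph.fromRel (fun a b =>
    (∃ a' b', a = some a' ∧ b = some b' ∧ F.Adj a' b') ∨ a = none)

/-- `F⁺⁺`: the graph `F` together with a new vertex `y = some none` adjacent to all of
`F`, and a further new vertex `x = none` adjacent only to `y`. -/
def addUnivPendant {W : Type*} (F : SimpleGraph W) : SimpleGraph (Option (Option W)) :=
  SimpleGraph.fromRel (fun a b =>
    (∃ a' b', a = some (some a') ∧ b = some (some b') ∧ F.Adj a' b') ∨ a = some none)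

theorem emb_univ {V W : Type*} {G : SimpleGraph V} {F : SimpleGraph W} (f : F ↪g G) (y : V)
    (hy : ∀ w, G.Adj y (f w)) : Nonempty (addUniv F ↪g G) := by
  have hne : ∀ w, y ≠ f w := fun w => (hy w).ne
  refine ⟨⟨⟨fun o => o.elim y f, ?_⟩, ?_⟩⟩
  · rintro (_ | a) (_ | b) h
    · rfl
    · exact absurd h (hne b)
    · exact absurd h.symm (hne a)
    · exact congrArg some (f.injective h)
  · rintro (_ | a) (_ | b)
    · change G.Adj y y ↔ _
      simp [addUniv]
    · change G.Adj y (f b) ↔ _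
      simp [addUniv, hy]
    · change G.Adj (f a) y ↔ _
      simp [addUniv, (hy a).symm]
    · change G.Adj (f a) (f b) ↔ _
      simp only [addUniv, SimpleGraph.fromRel_adj]
      simp [F.adj_comm b a, f.map_adj_iff]
      exact fun h => h.ne

theorem emb_pend {V W : Type*} {G : SimpleGraph V} {F : SimpleGraph W} (f : F ↪g G) (x y : V)
    (hy : ∀ w, G.Adj y (f w)) (hxy : G.Adj x y) (hx : ∀ w, ¬ G.Adj x (f w))
    (hxn : ∀ w, x ≠ f w) : Nonempty (addUnivPendant F ↪g G) := by
  have hne : ∀ w, y ≠ f w := fun w => (hy w).ne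
  have hx' : ∀ w, ¬ G.Adj (f w) x := fun w h => hx w h.symm
  refine ⟨⟨⟨fun o => o.elim x (fun o => o.elim y f), ?_⟩, ?_⟩⟩
  · rintro (_ | _ | a) (_ | _ | b) h
    · rfl
    · exact absurd h hxy.ne
    · exact absurd h (hxn b)
    · exact absurd h.symm hxy.ne
    · rfl
    · exact absurd h (hne b)
    · exact absurd h.symm (hxn a)
    · exact absurd h.symm (hne a)
    · exact congrArg (fun t => some (some t)) (f.injective h)
  · rintro (_ | _ | a) (_ | _ | b)
    · change G.Adj x x ↔ _
      simp [addUnivPendant]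
    · change G.Adj x y ↔ _
      simp [addUnivPendant, hxy]
    · change G.Adj x (f b) ↔ _
      simp [addUnivPendant, hx]
    · change G.Adj y x ↔ _
      simp [addUnivPendant, hxy.symm]
    · change G.Adj y y ↔ _
      simp [addUnivPendant]
    · change G.Adj y (f b) ↔ _
      simp [addUnivPendant, hy]
    · change G.Adj (f a) x ↔ _
      simp [addUnivPendant, hx']
    · change G.Adj (f a) y ↔ _
      simp [addUnivPendant, (hy a).symm]
    · change G.Adj (f a) (f b) ↔ _
      simp only [addUnivPendant, SimpleGraph.fromRel_adj]
      simp [F.adj_comm b a, f.map_adj_iff]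
      exact fun h => h.ne

/-- With `X = {x₁,x₂,x₃}` as in the statement, `N_G[X]` a monitor,
and `A₁, A₂, A₃, A₄` the described partition of `V(G) \ X`: an induced copy of a
connected graph `F` inside `G[A₁]` yields an induced `F⁺` in `G`, and an induced copy
inside `G[A_i]` for `i ∈ {2,3,4}` yields an induced `F⁺⁺` in `G`. -/
theorem stmt8 {V W : Type*} [Fintype V] [Fintype W] (G : SimpleGraph V) (hG : G.Connected)
    (x1 x2 x3 : V) (h12 : x1 ≠ x2) (h13 : x1 ≠ x3) (h23 : x2 ≠ x3)
    (hadj12 : G.Adj x1 x2) (hadj3 : G.Adj x1 x3 ∨ G.Adj x2 x3)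
    (X A1 A2 A3 A4 : Set V) (hX : X = {x1, x2, x3})
    (hmon : Monitor G (closedNbhd G X))
    (hA1 : A1 = G.neighborSet x1 \ X)
    (hA2 : A2 = G.neighborSet x2 \ (X ∪ A1))
    (hA3 : A3 = G.neighborSet x3 \ (X ∪ A1 ∪ A2))
    (hA4 : A4 = Set.univ \ closedNbhd G X)
    (F : SimpleGraph W) (hF : F.Connected) :
    (Nonempty (F ↪g G.induce A1) → Nonempty (addUniv F ↪g G)) ∧
      ∀ A ∈ ({A2, A3, A4} : Set (Set V)),
        Nonempty (F ↪g G.induce A) → Nonempty (addUnivPendant F ↪g G) := by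
  have key : ∀ A : Set V, ∀ f : F ↪g G.induce A, ∃ g : F ↪g G, ∀ w, g w ∈ A := fun A f =>
    ⟨f.trans (SimpleGraph.Embedding.induce A), fun w => (f w).2⟩
  refine ⟨?_, ?_⟩
  · rintro ⟨f⟩
    obtain ⟨g, hg⟩ := key _ f
    refine emb_univ g x1 fun w => ?_
    have := hg w
    rw [hA1] at this
    exact this.1
  · rintro A (hA | hA | hA) ⟨f⟩
    · obtain ⟨g, hg⟩ := key _ f
      have hg' : ∀ w, G.Adj x2 (g w) ∧ g w ∉ X ∧ ¬ G.Adj x1 (g w) := by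
        intro w
        have := hg w
        rw [hA, hA2, hA1] at this
        simp only [Set.mem_diff, Set.mem_union, SimpleGraph.mem_neighborSet] at this
        tauto
      refine emb_pend g x1 x2 (fun w => (hg' w).1) hadj12 (fun w => (hg' w).2.2) fun w h => ?_
      exact (hg' w).2.1 (by rw [← h, hX]; simp)
    · obtain ⟨g, hg⟩ := key _ f
      have hg' : ∀ w, G.Adj x3 (g w) ∧ g w ∉ X ∧ ¬ G.Adj x1 (g w) ∧ ¬ G.Adj x2 (g w) := by
        intro w
        have := hg w
        rw [hA, hA3, hA2, hA1] at this
        simp only [Set.mem_diff, Set.mem_union, SimpleGraph.mem_neighborSet] at this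
        tauto
      rcases hadj3 with h3 | h3
      · refine emb_pend g x1 x3 (fun w => (hg' w).1) h3 (fun w => (hg' w).2.2.1) fun w h => ?_
        exact (hg' w).2.1 (by rw [← h, hX]; simp)
      · refine emb_pend g x2 x3 (fun w => (hg' w).1) h3 (fun w => (hg' w).2.2.2) fun w h => ?_
        exact (hg' w).2.1 (by rw [← h, hX]; simp)
    · have hA' : A = (closedNbhd G X)ᶜ := by
        rw [Set.mem_singleton_iff.1 hA, hA4, Set.compl_eq_univ_diff]
      subst hA'
      obtain ⟨w0⟩ := hF.nonempty
      obtain ⟨y, hyM, hy⟩ := hmon ((G.induce (closedNbhd G X)ᶜ).connectedComponentMk (f w0))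
      have hy' : ∀ w, G.Adj y (f w) := fun w => hy (f w) <| by
        rw [SimpleGraph.ConnectedComponent.eq]
        exact (hF.preconnected w w0).map f.toHom
      have hn : ∀ w, ∀ x ∈ X, ¬ G.Adj x (f w) := fun w x hx h =>
        (f w).2 (Or.inr ⟨x, hx, h⟩)
      rcases hyM with hyX | ⟨x, hx, hxy⟩
      · exact absurd (hy' w0) (hn w0 y hyX)
      · refine emb_pend (f.trans (SimpleGraph.Embedding.induce _)) x y hy' hxy
          (fun w => hn w x hx) fun w h => (f w).2 (Or.inl ?_)
        have h' : x = (f w : V) := h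
        rw [← h']; exact hx
end

section
/- Let H0 be the graph with possible loops on vertex set {a_1,a_2,a_3,b_1,b_2,b_3,c_1,c_2,c_3,d_1,d_2,d_3} whose symmetric adjacency relation R consists of: all pairs (including loops) of vertices within {a_1,a_2,a_3,b_1,b_2,b_3}; all pairs (including loops) of vertices within {c_1,c_2,c_3,d_1,d_2,d_3}; the pairs a_i c_i and b_i c_i for each i ∈ {1,2,3}; and the pairs d_i a_i and d_i b_j for each i ∈ {1,2,3} and j ∈ {1,2,3} \ {i}. Given a graph G with vertices v_1, …, v_n, let G′ be the graph with vertices x_i, y_i, w_i for 1 ≤ i ≤ n and z_{i,j} for each edge v_i v_j of G with i < j, whose edges are: all pairs of distinct vertices within {x_1,…,x_n} ∪ {y_1,…,y_n}; the edges w_i x_i and w_i y_i for each i; and the edges z_{i,j} x_i and z_{i,j} y_j for each edge v_i v_j of G with i < j. Define lists L(x_i) = {a_1,a_2,a_3}, L(y_i) = {b_1,b_2,b_3}, L(w_i) = {c_1,c_2,c_3}, and L(z_{i,j}) = {d_1,d_2,d_3}. Then G admits a proper 3-coloring if and only if there exists a map φ : V(G′) → V(H0) such that φ(v) ∈ L(v)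 for every vertex v of G′ and R(φ(u), φ(u′)) holds for every edge uu′ of G′. -/
/-- Vertices of `H₀`: `(k, i)` where `k = 0,1,2,3` stands for `a, b, c, d`
respectively and `i ∈ {1,2,3}` is the index. -/
abbrev H0V := Fin 4 × Fin 3

/-- The (symmetric, possibly reflexive) adjacency relation of `H₀`: all pairs within
`{a_i, b_i}` (loops included), all pairs within `{c_i, d_i}` (loops included), the
pairs `a_i c_i`, `b_i c_i`, `d_i a_i`, and the pairs `d_i b_j` for `j ≠ i`. -/
def H0Rel (p q : H0V) : Prop :=
  ((p.1 = 0 ∨ p.1 = 1) ∧ (q.1 = 0 ∨ q.1 = 1)) ∨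
  ((p.1 = 2 ∨ p.1 = 3) ∧ (q.1 = 2 ∨ q.1 = 3)) ∨
  (p.1 = 0 ∧ q.1 = 2 ∧ p.2 = q.2) ∨ (p.1 = 2 ∧ q.1 = 0 ∧ p.2 = q.2) ∨
  (p.1 = 1 ∧ q.1 = 2 ∧ p.2 = q.2) ∨ (p.1 = 2 ∧ q.1 = 1 ∧ p.2 = q.2) ∨
  (p.1 = 3 ∧ q.1 = 0 ∧ p.2 = q.2) ∨ (p.1 = 0 ∧ q.1 = 3 ∧ p.2 = q.2) ∨
  (p.1 = 3 ∧ q.1 = 1 ∧ p.2 ≠ q.2) ∨ (p.1 = 1 ∧ q.1 = 3 ∧ p.2 ≠ q.2)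

/-- The vertices of `G′`: `Sum.inl (i, 0) = x_i`, `Sum.inl (i, 1) = y_i`,
`Sum.inl (i, 2) = w_i`, and `Sum.inr ⟨(i,j), _⟩ = z_{i,j}` for each edge `v_i v_j`
of `G` with `i < j`. -/
def Vprime (n : ℕ) (G : SimpleGraph (Fin n)) : Type :=
  (Fin n × Fin 3) ⊕ {p : Fin n × Fin n // G.Adj p.1 p.2 ∧ p.1 < p.2}

/-- The graph `G′`: all pairs of distinct vertices within `{x_i} ∪ {y_i}` are edges;
`w_i` is adjacent to `x_i` and `y_i`; and `z_{i,j}` is adjacent to `x_i` and `y_j`. -/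
def Gprime (n : ℕ) (G : SimpleGraph (Fin n)) : SimpleGraph (Vprime n G) :=
  SimpleGraph.fromRel (fun a b =>
    (∃ i i' k k', k ≠ 2 ∧ k' ≠ 2 ∧ a = Sum.inl (i, k) ∧ b = Sum.inl (i', k')) ∨
    (∃ i k, k ≠ 2 ∧ a = Sum.inl (i, (2 : Fin 3)) ∧ b = Sum.inl (i, k)) ∨
    (∃ e : {p : Fin n × Fin n // G.Adj p.1 p.2 ∧ p.1 < p.2},
      a = Sum.inr e ∧ (b = Sum.inl (e.1.1, 0) ∨ b = Sum.inl (e.1.2, 1))))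

/-- The lists: `L(x_i) = {a_1,a_2,a_3}`, `L(y_i) = {b_1,b_2,b_3}`,
`L(w_i) = {c_1,c_2,c_3}`, `L(z_{i,j}) = {d_1,d_2,d_3}`. -/
def lists (n : ℕ) (G : SimpleGraph (Fin n)) : Vprime n G → Set H0V := fun v =>
  match v with
  | Sum.inl (_, k) => {p | (p.1 : ℕ) = (k : ℕ)}
  | Sum.inr _ => {p | p.1 = 3}

theorem H0Rel_symm {p q : H0V} (h : H0Rel p q) : H0Rel q p := by
  unfold H0Rel at *
  grind

theorem H0Rel_ac {p q : H0V} (hp : p.1 = 0) (hq : q.1 = 2) (h : H0Rel q p) : p.2 = q.2 := by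
  unfold H0Rel at h
  simp [hp, hq] at h
  exact h.symm

theorem H0Rel_bc {p q : H0V} (hp : p.1 = 1) (hq : q.1 = 2) (h : H0Rel q p) : p.2 = q.2 := by
  unfold H0Rel at h
  simp [hp, hq] at h
  exact h.symm

theorem H0Rel_da {p q : H0V} (hp : p.1 = 0) (hq : q.1 = 3) (h : H0Rel q p) : p.2 = q.2 := by
  unfold H0Rel at h
  simp [hp, hq] at h
  exact h.symm

theorem H0Rel_db {p q : H0V} (hp : p.1 = 1) (hq : q.1 = 3) (h : H0Rel q p) : q.2 ≠ p.2 := by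
  unfold H0Rel at h
  simpa [hp, hq] using h

/-- The `H₀`-coloring built from a 3-coloring `c`. -/
def phiOf (n : ℕ) (G : SimpleGraph (Fin n)) (c : Fin n → Fin 3) : Vprime n G → H0V := fun v =>
  match v with
  | Sum.inl (i, k) => (k.castSucc, c i)
  | Sum.inr e => (3, c e.1.1)

/-- `G` admits a proper 3-coloring iff `G′` admits an `H₀`-coloring
respecting the lists `L`. -/
theorem stmt19 (n : ℕ) (G : SimpleGraph (Fin n)) :
    (∃ c : Fin n → Fin 3, ∀ u v, G.Adj u v → c u ≠ c v) ↔
      (∃ φ : Vprime n G → H0V,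
        (∀ v, φ v ∈ lists n G v) ∧
        ∀ u u', (Gprime n G).Adj u u' → H0Rel (φ u) (φ u')) := by
  constructor
  · rintro ⟨c, hc⟩
    refine ⟨phiOf n G c, ?_, ?_⟩
    · rintro (⟨i, k⟩ | e)
      · simp [phiOf, lists]
      · simp [phiOf, lists]
    · intro u u' h
      rw [Gprime, SimpleGraph.fromRel_adj] at h
      have key : ∀ a b : Vprime n G,
          ((∃ i i' k k', k ≠ 2 ∧ k' ≠ 2 ∧ a = Sum.inl (i, k) ∧ b = Sum.inl (i', k')) ∨
          (∃ i k, k ≠ 2 ∧ a = Sum.inl (i, (2 : Fin 3)) ∧ b = Sum.inl (i, k)) ∨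
          (∃ e : {p : Fin n × Fin n // G.Adj p.1 p.2 ∧ p.1 < p.2},
            a = Sum.inr e ∧ (b = Sum.inl (e.1.1, 0) ∨ b = Sum.inl (e.1.2, 1)))) →
          H0Rel (phiOf n G c a) (phiOf n G c b) := by
        rintro a b (⟨i, i', k, k', hk, hk', rfl, rfl⟩ | ⟨i, k, hk, rfl, rfl⟩ |
          ⟨e, rfl, rfl | rfl⟩)
        · fin_cases k <;> fin_cases k' <;> simp_all [phiOf, H0Rel]
        · fin_cases k <;> simp_all [phiOf, H0Rel]
        · simp [phiOf, H0Rel]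
        · simpa [phiOf, H0Rel] using hc _ _ e.2.1
      rcases h.2 with h | h
      · exact key _ _ h
      · exact H0Rel_symm (key _ _ h)
  · rintro ⟨φ, hL, hφ⟩
    have hx : ∀ i, (φ (Sum.inl (i, 0))).1 = 0 := fun i => Fin.ext (hL (Sum.inl (i, 0)))
    have hy : ∀ i, (φ (Sum.inl (i, 1))).1 = 1 := fun i => Fin.ext (hL (Sum.inl (i, 1)))
    have hw : ∀ i, (φ (Sum.inl (i, 2))).1 = 2 := fun i => Fin.ext (hL (Sum.inl (i, 2)))
    have hz : ∀ e, (φ (Sum.inr e)).1 = 3 := fun e => hL (Sum.inr e)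
    have hxy : ∀ i, (φ (Sum.inl (i, 0))).2 = (φ (Sum.inl (i, 1))).2 := by
      intro i
      rw [H0Rel_ac (hx i) (hw i), H0Rel_bc (hy i) (hw i)]
      · apply hφ
        refine (SimpleGraph.fromRel_adj _ _ _).2 ?_
        refine ⟨fun h => ?_, Or.inl (Or.inr (Or.inl ⟨i, 1, by decide, rfl, rfl⟩))⟩
        have := congrArg Prod.snd (Sum.inl.inj h)
        simp at this
      · apply hφ
        refine (SimpleGraph.fromRel_adj _ _ _).2 ?_
        refine ⟨fun h => ?_, Or.inl (Or.inr (Or.inl ⟨i, 0, by decide, rfl, rfl⟩))⟩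
        have := congrArg Prod.snd (Sum.inl.inj h)
        simp at this
    have main : ∀ u v, G.Adj u v → u < v →
        (φ (Sum.inl (u, 0))).2 ≠ (φ (Sum.inl (v, 0))).2 := by
      intro u v huv hlt
      rw [hxy v, H0Rel_da (hx u) (hz ⟨(u, v), huv, hlt⟩)]
      · apply H0Rel_db (hy v) (hz _)
        apply hφ
        refine (SimpleGraph.fromRel_adj _ _ _).2 ?_
        exact ⟨fun h => (nomatch h),
          Or.inl (Or.inr (Or.inr ⟨⟨(u, v), huv, hlt⟩, rfl, Or.inr rfl⟩))⟩
      · apply hφ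
        refine (SimpleGraph.fromRel_adj _ _ _).2 ?_
        exact ⟨fun h => (nomatch h),
          Or.inl (Or.inr (Or.inr ⟨⟨(u, v), huv, hlt⟩, rfl, Or.inl rfl⟩))⟩
    refine ⟨fun i => (φ (Sum.inl (i, 0))).2, fun u v huv => ?_⟩
    rcases lt_or_gt_of_ne huv.ne with h | h
    · exact main u v huv h
    · exact (main v u huv.symm h).symm
end
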